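/- arXiv:0712.3878 — 2 statements merged into one kernel-verified Lean document; each statement's English description precedes it below -/
import Mathlib

section
/- Let X be an irreducible closed subvariety of ℙⁿ of dimension k over an algebraically closed field of characteristic zero. If there exists a (k−1)-dimensional linear subspace L of ℙⁿ such that L ⊆ T_p(X) for all points p in some dense open subset of X, then X is a k-dimensional linear subspace of ℙⁿ containing L. -/
/-!
Common framework: projective space over a field `K` with its Zariski topology,
lines, the Grassmannian `𝔾(1,n)` of lines (with the quotient Zariski topology
coming from the Stiefel-style parametrization by pairs of independent vectors),
the incidence variety `Δ(X)`, dimension of a subvariety as the topological Krull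
dimension of the corresponding subspace, irreducible components, dense open
subsets, embedded projective tangent spaces, joins and (tri)secant varieties.
-/

open MvPolynomial
open scoped LinearAlgebra.Projectivization

noncomputable section

variable (K : Type) [Field K]

/-- Projective `n`-space over `K`, with homogeneous coordinates indexed by `Fin (n+1)`. -/
abbrev Pn (n : ℕ) := ℙ K (Fin (n + 1) → K)

/-- The Zariski topology on `ℙⁿ`: generated by the basic open sets `D(f)` of
nonvanishing of homogeneous polynomials (nonvanishing of a homogeneous polynomial is
independent of the chosen representative). -/
instance projZariski (n : ℕ) : TopologicalSpace (Pn K n) :=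
  TopologicalSpace.generateFrom
    {U | ∃ (f : MvPolynomial (Fin (n + 1)) K) (d : ℕ), f.IsHomogeneous d ∧
      U = {x : Pn K n | eval x.rep f ≠ 0}}

/-- The projective linear subspace of `ℙⁿ` associated to a linear subspace `W ⊆ K^{n+1}`
(a `k`-dimensional projective linear subspace corresponds to `finrank W = k + 1`). -/
def projLinear {n : ℕ} (W : Submodule K (Fin (n + 1) → K)) : Set (Pn K n) :=
  {x | x.rep ∈ W}

/-- `l ⊆ ℙⁿ` is a (projective) line. -/
def IsLine {n : ℕ} (l : Set (Pn K n)) : Prop :=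
  ∃ W : Submodule K (Fin (n + 1) → K), Module.finrank K W = 2 ∧ l = projLinear K W

/-- The Grassmannian `𝔾(1,n)` of lines in `ℙⁿ`. -/
def Grass (n : ℕ) := {l : Set (Pn K n) // IsLine K l}

/-- Pairs of linearly independent vectors of `K^{n+1}` (parametrizing lines of `ℙⁿ`),
with the Zariski topology. -/
def Stiefel2 (n : ℕ) := {vw : Fin 2 → Fin (n + 1) → K // LinearIndependent K vw}

/-- The affine Zariski topology on the space of pairs of vectors. -/
def affZariski2 (n : ℕ) : TopologicalSpace (Fin 2 → Fin (n + 1) → K) :=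
  TopologicalSpace.generateFrom
    {U | ∃ f : MvPolynomial (Fin 2 × Fin (n + 1)) K,
      U = {v | eval (fun p => v p.1 p.2) f ≠ 0}}

instance (n : ℕ) : TopologicalSpace (Stiefel2 K n) :=
  letI := affZariski2 K n
  inferInstanceAs (TopologicalSpace {vw : Fin 2 → Fin (n + 1) → K // LinearIndependent K vw})

/-- The line of `ℙⁿ` spanned by a pair of independent vectors. -/
def lineOf {n : ℕ} (vw : Stiefel2 K n) : Grass K n :=
  ⟨projLinear K (Submodule.span K (Set.range vw.1)),
    Submodule.span K (Set.range vw.1), by rw [finrank_span_eq_card vw.2]; simp, rfl⟩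

/-- The Zariski topology on the Grassmannian of lines: the quotient topology induced by the
parametrization by pairs of independent vectors. -/
instance (n : ℕ) : TopologicalSpace (Grass K n) :=
  TopologicalSpace.coinduced (lineOf K (n := n)) inferInstance

/-- `Δ(X)`: the variety of lines incident to `X`. -/
def Delta {n : ℕ} (X : Set (Pn K n)) : Set (Grass K n) :=
  {l | (l.1 ∩ X).Nonempty}

/-- The dimension of a subvariety `S` of a (Zariski-topologized) space: the topological
Krull dimension of `S` with the subspace topology (sup of lengths of chains of irreducible
closed subsets). -/
def sdim {α : Type*} [TopologicalSpace α] (S : Set α) : WithBot ℕ∞ :=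
  topologicalKrullDim S

/-- `C` is an irreducible component of `S`: a maximal irreducible closed subset of `S`. -/
def IsIrredCompOf {α : Type*} [TopologicalSpace α] (C S : Set α) : Prop :=
  C ⊆ S ∧ IsIrreducible C ∧ IsClosed C ∧
    ∀ C' : Set α, C ⊆ C' → C' ⊆ S → IsIrreducible C' → IsClosed C' → C' = C

/-- `U` is a dense open subset of `X` (open in the subspace topology of `X`, dense in `X`). -/
def IsDenseOpenIn {α : Type*} [TopologicalSpace α] (U X : Set α) : Prop :=
  U ⊆ X ∧ (∃ V : Set α, IsOpen V ∧ U = X ∩ V) ∧ X ⊆ closure U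

/-- The embedded projective tangent space of `X ⊆ ℙⁿ` at `p`: the zero locus of the
differentials at `p` of all homogeneous polynomials vanishing on `X`. -/
def tangentSpace {n : ℕ} (X : Set (Pn K n)) (p : Pn K n) : Set (Pn K n) :=
  {y | ∀ (f : MvPolynomial (Fin (n + 1)) K) (d : ℕ), f.IsHomogeneous d →
    (∀ x ∈ X, eval x.rep f = 0) →
    (∑ i, eval p.rep (pderiv i f) * y.rep i) = 0}

/-- The line of `ℙⁿ` through two (distinct) points. -/
def lineThrough {n : ℕ} (p q : Pn K n) : Set (Pn K n) :=
  projLinear K (Submodule.span K {p.rep, q.rep})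

/-- The set of lines spanned by pairs of distinct points `(p,q) ∈ Y₁ × Y₂`. -/
def joinLines {n : ℕ} (Y₁ Y₂ : Set (Pn K n)) : Set (Grass K n) :=
  {l | ∃ p ∈ Y₁, ∃ q ∈ Y₂, p ≠ q ∧ p ∈ l.1 ∧ q ∈ l.1}

/-- The joining component of the join `J(Y₁,Y₂)`: the closure in `𝔾(1,n)` of the set of
lines spanned by pairs of distinct points of `Y₁ × Y₂`. -/
def joiningComponent {n : ℕ} (Y₁ Y₂ : Set (Pn K n)) : Set (Grass K n) :=
  closure (joinLines K Y₁ Y₂)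

/-- The union of the lines belonging to a family `S ⊆ 𝔾(1,n)`. -/
def linesUnion {n : ℕ} (S : Set (Grass K n)) : Set (Pn K n) :=
  ⋃ l ∈ S, l.1

/-- `V₁,₃(Z)`: the variety of trisecant lines of `Z`, the closure in `𝔾(1,n)` of the set of
lines meeting `Z` in (at least) three pairwise distinct points. -/
def trisecants {n : ℕ} (Z : Set (Pn K n)) : Set (Grass K n) :=
  closure {l | ∃ p ∈ Z, ∃ q ∈ Z, ∃ s ∈ Z,
    p ≠ q ∧ p ≠ s ∧ q ≠ s ∧ p ∈ l.1 ∧ q ∈ l.1 ∧ s ∈ l.1}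

/-- `V₁,₃(Y,Z)`: the closure in `𝔾(1,n)` of the set of lines through a point of `Y` and two
distinct points of `Z \ Y`. -/
def trisecantsRel {n : ℕ} (Y Z : Set (Pn K n)) : Set (Grass K n) :=
  closure {l | ∃ p ∈ Y, ∃ q₁ ∈ Z \ Y, ∃ q₂ ∈ Z \ Y,
    q₁ ≠ q₂ ∧ p ∈ l.1 ∧ q₁ ∈ l.1 ∧ q₂ ∈ l.1}

/-- `Z` has degree at least 3: some line meets `Z` in at least three (isolated) points,
i.e. the (finite) intersection with some line has at least `3` points. -/
def degreeGE3 {n : ℕ} (Z : Set (Pn K n)) : Prop :=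
  ∃ l : Grass K n, (l.1 ∩ Z).Finite ∧ 3 ≤ (l.1 ∩ Z).ncard

end

open Module Order TopologicalSpace

namespace ProjectiveZariski

section Polynomials

variable {K : Type} [Field K] {σ : Type*}

lemma eval_smul_of_isHomogeneous {f : MvPolynomial σ K} {d : ℕ} (hf : f.IsHomogeneous d)
    (c : K) (v : σ → K) : eval (c • v) f = c ^ d * eval v f := by
  simp only [eval_eq, Finset.mul_sum]
  refine Finset.sum_congr rfl fun m hm => ?_
  rw [hf.degree_eq_sum_deg_support hm]
  simp only [Pi.smul_apply, smul_eq_mul, mul_pow, Finset.prod_mul_distrib,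
    Finset.prod_pow_eq_pow_sum]
  ring

/-- The restriction of a polynomial to the parametrized line `t ↦ a + t • b`. -/
noncomputable def restrictLine (a b : σ → K) : MvPolynomial σ K →ₐ[K] Polynomial K :=
  aeval fun i => Polynomial.C (a i) + Polynomial.C (b i) * Polynomial.X

lemma eval_restrictLine (a b : σ → K) (f : MvPolynomial σ K) (t : K) :
    (restrictLine a b f).eval t = eval (a + t • b) f := by
  induction f using MvPolynomial.induction_on with
  | C r => simp [restrictLine]
  | add p q hp hq => simp [hp, hq]
  | mul_X p i hp =>
    have hX : (restrictLine a b (X i)).eval t = a i + t * b i := by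
      simp [restrictLine, mul_comm t]
    simp [hp, hX]

/-- The derivative of a polynomial in the constant direction `w`. -/
noncomputable def dirDeriv [Fintype σ] (w : σ → K) (f : MvPolynomial σ K) : MvPolynomial σ K :=
  ∑ i, C (w i) * pderiv i f

lemma isHomogeneous_dirDeriv [Fintype σ] (w : σ → K) {f : MvPolynomial σ K} {d : ℕ}
    (hf : f.IsHomogeneous d) : (dirDeriv w f).IsHomogeneous (d - 1) :=
  IsHomogeneous.sum _ _ _ fun _ _ => hf.pderiv.C_mul _

lemma eval_dirDeriv [Fintype σ] (w v : σ → K) (f : MvPolynomial σ K) :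
    eval v (dirDeriv w f) = ∑ i, eval v (pderiv i f) * w i := by
  simp [dirDeriv, mul_comm]

lemma derivative_restrictLine [Fintype σ] (a b : σ → K) (f : MvPolynomial σ K) :
    Polynomial.derivative (restrictLine a b f) = restrictLine a b (dirDeriv b f) := by
  classical
  have hC (r : K) : restrictLine a b (C r) = Polynomial.C r := by simp [restrictLine]
  induction f using MvPolynomial.induction_on with
  | C r => simp [dirDeriv, hC]
  | add p q hp hq => simp [hp, hq, dirDeriv, mul_add, Finset.sum_add_distrib]
  | mul_X p i hp =>
    have hX : restrictLine a b (X i) =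
        Polynomial.C (a i) + Polynomial.C (b i) * Polynomial.X := by simp [restrictLine]
    have hD : dirDeriv b (p * X i) = dirDeriv b p * X i + C (b i) * p := by
      simp only [dirDeriv, pderiv_mul, pderiv_X, mul_add, Finset.sum_add_distrib, Finset.sum_mul]
      congr 1
      · exact Finset.sum_congr rfl fun j _ => by ring
      · simp [Pi.single_apply, mul_comm]
    rw [hD, map_mul, Polynomial.derivative_mul, hp, map_add, map_mul, map_mul, hC, hX]
    simp
    ring

lemma sum_eval_homogeneousComponent_smul (f : MvPolynomial σ K) (c : K) (v : σ → K) :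
    eval (c • v) f =
      ∑ d ∈ Finset.range (f.totalDegree + 1), eval v (homogeneousComponent d f) * c ^ d := by
  conv_lhs => rw [← sum_homogeneousComponent f]
  rw [map_sum]
  exact Finset.sum_congr rfl fun d _ => by
    rw [eval_smul_of_isHomogeneous (homogeneousComponent_isHomogeneous d f), mul_comm]

lemma forall_eval_smul_eq_zero_iff [Infinite K] (f : MvPolynomial σ K) (v : σ → K) :
    (∀ c : K, eval (c • v) f = 0) ↔ ∀ d, eval v (homogeneousComponent d f) = 0 := by
  refine ⟨fun h d => ?_, fun h c => by simp [sum_eval_homogeneousComponent_smul, h]⟩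
  by_cases hd : f.totalDegree < d
  · simp [homogeneousComponent_eq_zero _ _ hd]
  have hq : (∑ e ∈ Finset.range (f.totalDegree + 1),
      Polynomial.C (eval v (homogeneousComponent e f)) * Polynomial.X ^ e) = 0 := by
    refine Polynomial.funext fun c => ?_
    simpa [Polynomial.eval_finsetSum, ← sum_eval_homogeneousComponent_smul] using h c
  have := congrArg (fun q => Polynomial.coeff q d) hq
  simp only [Polynomial.finsetSum_coeff, Polynomial.coeff_C_mul_X_pow] at this
  rw [Finset.sum_ite_eq, if_pos (by simp; omega)] at this
  simpa using this

end Polynomials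

section Zariski

variable {K : Type} [Field K] {n : ℕ}

lemma isClosed_zeroLocus {f : MvPolynomial (Fin (n + 1)) K} {d : ℕ} (hf : f.IsHomogeneous d) :
    IsClosed {x : Pn K n | eval x.rep f = 0} :=
  ⟨TopologicalSpace.GenerateOpen.basic _ ⟨f, d, hf, rfl⟩⟩

lemma isTopologicalBasis_basicOpen : IsTopologicalBasis
    {U : Set (Pn K n) | ∃ (f : MvPolynomial (Fin (n + 1)) K) (d : ℕ), f.IsHomogeneous d ∧
      U = {x : Pn K n | eval x.rep f ≠ 0}} := by
  have h := isTopologicalBasis_of_subbasis_of_inter (t := projZariski K n) rfl (by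
    rintro _ ⟨f, d, hf, rfl⟩ _ ⟨g, e, hg, rfl⟩
    exact ⟨f * g, d + e, hf.mul hg, by ext; simp⟩)
  rwa [Set.insert_eq_of_mem] at h
  exact ⟨1, 0, isHomogeneous_one _ _, by simp⟩

lemma exists_isHomogeneous_of_notMem {Z : Set (Pn K n)} (hZ : IsClosed Z) {p : Pn K n}
    (hp : p ∉ Z) : ∃ (f : MvPolynomial (Fin (n + 1)) K) (d : ℕ), f.IsHomogeneous d ∧
      (∀ x ∈ Z, eval x.rep f = 0) ∧ eval p.rep f ≠ 0 := by
  obtain ⟨_, ⟨f, d, hf, rfl⟩, hpf, hsub⟩ :=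
    isTopologicalBasis_basicOpen.exists_subset_of_mem_open (a := p) hp hZ.isOpen_compl
  exact ⟨f, d, hf, fun x hx => by_contra fun h => hsub h hx, hpf⟩

lemma rep_mk_mem_iff (W : Submodule K (Fin (n + 1) → K)) {v : Fin (n + 1) → K} (hv : v ≠ 0) :
    (Projectivization.mk K v hv).rep ∈ W ↔ v ∈ W := by
  obtain ⟨a, ha⟩ := Projectivization.exists_smul_eq_mk_rep K v hv
  rw [← ha]
  exact W.smul_mem_iff_of_isUnit a.isUnit

lemma mk_mem_projLinear (W : Submodule K (Fin (n + 1) → K)) {v : Fin (n + 1) → K} (hv : v ≠ 0) :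
    Projectivization.mk K v hv ∈ projLinear K W ↔ v ∈ W :=
  rep_mk_mem_iff W hv

lemma eval_rep_mk_eq_zero_iff {f : MvPolynomial (Fin (n + 1)) K} {d : ℕ} (hf : f.IsHomogeneous d)
    {v : Fin (n + 1) → K} (hv : v ≠ 0) :
    eval (Projectivization.mk K v hv).rep f = 0 ↔ eval v f = 0 := by
  obtain ⟨a, ha⟩ := Projectivization.exists_smul_eq_mk_rep K v hv
  rw [← ha, Units.smul_def, eval_smul_of_isHomogeneous hf]
  simp

lemma projLinear_le_iff {W W' : Submodule K (Fin (n + 1) → K)} :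
    projLinear K W ⊆ projLinear K W' ↔ W ≤ W' := by
  refine ⟨fun h v hv => ?_, fun h x hx => h hx⟩
  by_cases h0 : v = 0
  · simp [h0]
  · exact (mk_mem_projLinear W' h0).1 (h ((mk_mem_projLinear W h0).2 hv))

lemma isClosed_projLinear (W : Submodule K (Fin (n + 1) → K)) : IsClosed (projLinear K W) := by
  classical
  have hW : projLinear K W = ⋂ φ : {φ : (Fin (n + 1) → K) →ₗ[K] K // W ≤ LinearMap.ker φ},
      {x : Pn K n | eval x.rep (∑ i, C (φ.1 (Pi.single i 1)) * X i :
        MvPolynomial (Fin (n + 1)) K) = 0} := by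
    have key (φ : (Fin (n + 1) → K) →ₗ[K] K) (v : Fin (n + 1) → K) :
        eval v (∑ i, C (φ (Pi.single i 1)) * X i : MvPolynomial (Fin (n + 1)) K) = φ v := by
      simp only [map_sum, map_mul, eval_C, eval_X]
      conv_rhs => rw [LinearMap.pi_apply_eq_sum_univ φ v]
      exact Finset.sum_congr rfl fun i _ => by
        rw [smul_eq_mul, mul_comm]; congr 3; ext j; simp [Pi.single_apply, eq_comm]
    ext x
    simp only [Set.mem_iInter, Set.mem_ofPred_eq, key]
    refine ⟨fun hx φ => φ.2 hx, fun h => by_contra fun hx => ?_⟩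
    obtain ⟨φ, hφ, hle⟩ := W.exists_le_ker_of_notMem (v := x.rep) hx
    exact hφ (h ⟨φ, hle⟩)
  rw [hW]
  exact isClosed_iInter fun φ => isClosed_zeroLocus
    (IsHomogeneous.sum _ _ 1 fun i _ => isHomogeneous_C_mul_X _ _)

lemma isIrreducible_projLinear [Infinite K] {W : Submodule K (Fin (n + 1) → K)} (hW : W ≠ ⊥) :
    IsIrreducible (projLinear K W) := by
  obtain ⟨w, hwW, hw⟩ := W.ne_bot_iff.1 hW
  refine ⟨⟨_, (mk_mem_projLinear W hw).2 hwW⟩, fun U V hU hV ⟨x, hxW, hxU⟩ ⟨y, hyW, hyV⟩ => ?_⟩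
  obtain ⟨_, ⟨f, d, hf, rfl⟩, hxf, hfU⟩ :=
    isTopologicalBasis_basicOpen.exists_subset_of_mem_open hxU hU
  obtain ⟨_, ⟨g, e, hg, rfl⟩, hyg, hgV⟩ :=
    isTopologicalBasis_basicOpen.exists_subset_of_mem_open hyV hV
  obtain ⟨i, hi⟩ := Function.ne_iff.1 x.rep_nonzero
  set ℓ := restrictLine x.rep (y.rep - x.rep) with hℓ
  have hne : ℓ f * ℓ g * ℓ (X i) ≠ 0 := by
    refine mul_ne_zero (mul_ne_zero ?_ ?_) ?_
    · intro h
      have := eval_restrictLine x.rep (y.rep - x.rep) f 0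
      simp_all
    · intro h
      have := eval_restrictLine x.rep (y.rep - x.rep) g 1
      simp_all
    · intro h
      have := eval_restrictLine x.rep (y.rep - x.rep) (X i) 0
      simp_all
  obtain ⟨t, ht⟩ : ∃ t, (ℓ f * ℓ g * ℓ (X i)).eval t ≠ 0 := by
    by_contra! h
    exact hne (Polynomial.funext fun t => by simp [h t])
  simp only [Polynomial.eval_mul, hℓ, eval_restrictLine, mul_ne_zero_iff] at ht
  obtain ⟨⟨hft, hgt⟩, hit⟩ := ht
  set v := x.rep + t • (y.rep - x.rep) with hv
  have hv0 : v ≠ 0 := fun h => hit (by simp [h])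
  refine ⟨Projectivization.mk K v hv0, (mk_mem_projLinear W hv0).2 ?_, hfU ?_, hgV ?_⟩
  · exact W.add_mem hxW (W.smul_mem _ (W.sub_mem hyW hxW))
  · exact (eval_rep_mk_eq_zero_iff hf hv0).not.2 hft
  · exact (eval_rep_mk_eq_zero_iff hg hv0).not.2 hgt

/-- A nonzero linear subspace as an irreducible closed subset of projective space. -/
def linearIrreducibleCloseds [Infinite K] (W : Submodule K (Fin (n + 1) → K)) (hW : W ≠ ⊥) :
    IrreducibleCloseds (Pn K n) :=
  ⟨projLinear K W, isIrreducible_projLinear hW, isClosed_projLinear W⟩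

/-- The ideal of polynomials vanishing on the affine cone over `Z`. -/
def coneIdeal (Z : Set (Pn K n)) : Ideal (MvPolynomial (Fin (n + 1)) K) where
  carrier := {f | ∀ x ∈ Z, ∀ c : K, eval (c • x.rep) f = 0}
  add_mem' hf hg x hx c := by simp [hf x hx c, hg x hx c]
  zero_mem' := by simp
  smul_mem' a f hf x hx c := by simp [hf x hx c]

lemma isPrime_coneIdeal [Infinite K] {Z : Set (Pn K n)} (hZ : IsIrreducible Z) :
    (coneIdeal Z).IsPrime := by
  have hcl (f : MvPolynomial (Fin (n + 1)) K) :
      IsClosed {x : Pn K n | ∀ c : K, eval (c • x.rep) f = 0} := by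
    simp only [forall_eval_smul_eq_zero_iff, Set.ofPred_forall]
    exact isClosed_iInter fun d => isClosed_zeroLocus (homogeneousComponent_isHomogeneous d f)
  rw [Ideal.isPrime_iff]
  refine ⟨fun h => ?_, fun {f g} hfg => ?_⟩
  · obtain ⟨x, hx⟩ := hZ.nonempty
    have : (1 : MvPolynomial (Fin (n + 1)) K) ∈ coneIdeal Z := h ▸ Submodule.mem_top
    simpa using this x hx 0
  · refine isPreirreducible_iff_isClosed_union_isClosed.1 hZ.isPreirreducible _ _ (hcl f) (hcl g)
      fun x hx => ?_
    have hzero : restrictLine 0 x.rep f * restrictLine 0 x.rep g = 0 := by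
      refine Polynomial.funext fun c => ?_
      simpa [eval_restrictLine] using hfg x hx c
    refine (mul_eq_zero.1 hzero).imp (fun h c => ?_) fun h c => ?_
    · simpa [h] using (eval_restrictLine 0 x.rep f c).symm
    · simpa [h] using (eval_restrictLine 0 x.rep g c).symm

lemma coneIdeal_lt_coneIdeal {Z Z' : Set (Pn K n)} (hZ : IsClosed Z) (h : Z ⊂ Z') :
    coneIdeal Z' < coneIdeal Z := by
  obtain ⟨hle, p, hpZ', hpZ⟩ := Set.ssubset_iff_exists.1 h
  obtain ⟨f, d, hf, hfZ, hfp⟩ := exists_isHomogeneous_of_notMem hZ hpZ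
  refine lt_of_le_of_ne (fun g hg x hx => hg x (hle hx)) fun heq => hfp ?_
  have hfI : f ∈ coneIdeal Z := fun x hx c => by
    rw [eval_smul_of_isHomogeneous hf, hfZ x hx, mul_zero]
  rw [← heq] at hfI
  simpa using hfI p hpZ' 1

lemma coneIdeal_lt_ker_eval_zero {Z : Set (Pn K n)} (hZ : Z.Nonempty) :
    coneIdeal Z < RingHom.ker (eval (0 : Fin (n + 1) → K)) := by
  obtain ⟨x, hx⟩ := hZ
  refine lt_of_le_of_ne (fun f hf => by simpa using hf x hx 0) fun heq => x.rep_nonzero ?_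
  ext i
  have : (X i : MvPolynomial (Fin (n + 1)) K) ∈ coneIdeal Z := by rw [heq]; simp
  simpa using this x hx 1

lemma krullDim_irreducibleCloseds_le [Infinite K] : krullDim (IrreducibleCloseds (Pn K n)) ≤ n := by
  cases isEmpty_or_nonempty (IrreducibleCloseds (Pn K n))
  · simp [krullDim_eq_bot]
  let F : WithBot (IrreducibleCloseds (Pn K n)) → (PrimeSpectrum (MvPolynomial (Fin (n + 1)) K))ᵒᵈ
    | ⊥ => OrderDual.toDual ⟨RingHom.ker (eval (0 : Fin (n + 1) → K)), RingHom.ker_isPrime _⟩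
    | (Z : IrreducibleCloseds (Pn K n)) =>
      OrderDual.toDual ⟨coneIdeal Z, isPrime_coneIdeal Z.isIrreducible⟩
  have hF : StrictMono F := by
    intro Y Z hYZ
    induction Z with
    | bot => simp at hYZ
    | coe Z =>
      induction Y with
      | bot => exact coneIdeal_lt_ker_eval_zero Z.isIrreducible.nonempty
      | coe Y => exact coneIdeal_lt_coneIdeal Y.isClosed (by simpa using hYZ)
  have h := krullDim_le_of_strictMono F hF
  rw [krullDim_withBot, krullDim_orderDual] at h
  have hdim : krullDim (PrimeSpectrum (MvPolynomial (Fin (n + 1)) K)) = n + 1 := by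
    change ringKrullDim _ = _
    simp [ringKrullDim_eq_zero_of_field]
  rw [hdim] at h
  exact ENat.WithBot.add_le_add_one_right_iff.1 h

lemma linearIrreducibleCloseds_lt [Infinite K] {W W' : Submodule K (Fin (n + 1) → K)}
    (hW : W ≠ ⊥) (hW' : W' ≠ ⊥) (h : W < W') :
    linearIrreducibleCloseds W hW < linearIrreducibleCloseds W' hW' :=
  ⟨projLinear_le_iff.2 h.le, fun h' => h.not_ge (projLinear_le_iff.1 h')⟩

lemma le_height_linearIrreducibleCloseds [Infinite K] {m : ℕ}
    (W : Submodule K (Fin (n + 1) → K)) (hW : W ≠ ⊥) (h : finrank K W = m + 1) :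
    (m : ℕ∞) ≤ height (linearIrreducibleCloseds W hW) := by
  induction m generalizing W with
  | zero => simp
  | succ m ih =>
    obtain ⟨v, hv⟩ := exists_linearIndependent_of_le_finrank (R := K) (M := W)
      (n := m + 1) (by omega)
    have hv' := hv.map' W.subtype W.ker_subtype
    set W' := Submodule.span K (Set.range (W.subtype ∘ v)) with hW'
    have hfin : finrank K W' = m + 1 := by rw [hW', finrank_span_eq_card hv']; simp
    have hlt : W' < W := by
      refine lt_of_le_of_ne (Submodule.span_le.2 ?_) fun heq => ?_
      · rintro _ ⟨i, rfl⟩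
        exact (v i).2
      · rw [heq] at hfin
        omega
    have hne : W' ≠ ⊥ := fun hbot => by rw [hbot, finrank_bot] at hfin; omega
    push_cast
    exact (add_le_add_left (ih W' hne hfin) 1).trans
      (height_add_one_le (linearIrreducibleCloseds_lt hne hW hlt))

lemma le_coheight_linearIrreducibleCloseds [Infinite K] {m : ℕ}
    (W : Submodule K (Fin (n + 1) → K)) (hW : W ≠ ⊥) (h : finrank K W + m = n + 1) :
    (m : ℕ∞) ≤ coheight (linearIrreducibleCloseds W hW) := by
  induction m generalizing W with
  | zero => simp
  | succ m ih =>
    obtain ⟨v, -, hv⟩ := SetLike.exists_of_lt (lt_top_iff_ne_top.2 fun htop : W = ⊤ => by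
      rw [htop, finrank_top, finrank_fin_fun] at h; omega)
    have hfin := Submodule.finrank_sup_span_singleton hv
    have hlt : W < W ⊔ K ∙ v :=
      lt_of_le_of_ne le_sup_left fun heq => hv (heq ▸ Submodule.mem_sup_right
        (Submodule.mem_span_singleton_self v))
    have hne : W ⊔ K ∙ v ≠ ⊥ := (bot_le.trans_lt hlt).ne'
    push_cast
    exact (add_le_add_left (ih _ hne (by omega)) 1).trans
      (coheight_add_one_le (linearIrreducibleCloseds_lt hW hne hlt))

lemma height_linearIrreducibleCloseds [Infinite K] {m : ℕ}
    (W : Submodule K (Fin (n + 1) → K)) (hW : W ≠ ⊥) (h : finrank K W = m + 1) :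
    height (linearIrreducibleCloseds W hW) = m := by
  refine le_antisymm ?_ (le_height_linearIrreducibleCloseds W hW h)
  have hle : finrank K W ≤ n + 1 := by
    simpa using W.finrank_le
  obtain ⟨j, hj⟩ := Nat.exists_eq_add_of_le hle
  have hsum : height (linearIrreducibleCloseds W hW) + coheight (linearIrreducibleCloseds W hW)
      ≤ (n : ℕ∞) := by
    have : Nonempty (IrreducibleCloseds (Pn K n)) := ⟨linearIrreducibleCloseds W hW⟩
    have hdim := krullDim_irreducibleCloseds_le (K := K) (n := n)
    rw [krullDim_eq_iSup_height_add_coheight_of_nonempty] at hdim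
    exact (le_iSup (fun Z : IrreducibleCloseds (Pn K n) => height Z + coheight Z) _).trans
      (WithBot.coe_le_coe.1 hdim)
  have hco := le_coheight_linearIrreducibleCloseds (m := j) W hW (by omega)
  have h2 := (add_le_add_right hco _).trans hsum
  have hn : (n : ℕ∞) = m + j := by
    rw [← Nat.cast_add]; congr 1; omega
  rw [hn] at h2
  exact (ENat.add_le_add_iff_right (ENat.natCast_ne_top j)).1 h2

end Zariski

section Dimension

variable {α : Type*} [TopologicalSpace α]

lemma IsIrreducible.preimage_subtypeVal {X Z : Set α} (hZ : IsIrreducible Z)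
    (hZX : Z ⊆ X) : IsIrreducible ((↑) ⁻¹' Z : Set X) := by
  obtain ⟨z, hz⟩ := hZ.nonempty
  refine ⟨⟨⟨z, hZX hz⟩, hz⟩, ?_⟩
  rintro _ _ ⟨U, hU, rfl⟩ ⟨V, hV, rfl⟩ ⟨x, hx, hxU⟩ ⟨y, hy, hyV⟩
  obtain ⟨w, hw, hwU, hwV⟩ := hZ.isPreirreducible U V hU hV ⟨x, hx, hxU⟩ ⟨y, hy, hyV⟩
  exact ⟨⟨w, hZX hw⟩, hw, hwU, hwV⟩

lemma sdim_eq_height (Z : IrreducibleCloseds α) : sdim (Z : Set α) = height Z := by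
  rw [height_eq_krullDim_Iic]
  refine le_antisymm ?_ ?_
  · let F : IrreducibleCloseds (Z : Set α) → Set.Iic Z := fun Y =>
      ⟨Y.map Subtype.val continuous_subtype_val,
        Z.isClosed.closure_subset_iff.2 (Subtype.coe_image_subset _ _)⟩
    exact krullDim_le_of_strictMono F fun _ _ h =>
      IrreducibleCloseds.map_strictMono_of_isInducing Topology.IsInducing.subtypeVal h
  · let G : Set.Iic Z → IrreducibleCloseds (Z : Set α) := fun Y =>
      ⟨(↑) ⁻¹' (Y.1 : Set α), IsIrreducible.preimage_subtypeVal Y.1.isIrreducible Y.2,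
        Y.1.isClosed.preimage continuous_subtype_val⟩
    refine krullDim_le_of_strictMono G fun A B h => ⟨fun x hx => h.le hx, fun h' => h.not_ge ?_⟩
    exact fun x hx => h' (show (⟨x, B.2 hx⟩ : (Z : Set α)) ∈ G B from hx)

end Dimension

section Tangent

variable {K : Type} [Field K] {n : ℕ}

/-- If `v` lies in the embedded tangent space at every point of a dense subset of `Z`, then the
derivative in the direction `v` of an equation of `Z` again vanishes on `Z`. -/
lemma eval_dirDeriv_eq_zero {Z U : Set (Pn K n)} (hU : Z ⊆ closure U)
    {W : Submodule K (Fin (n + 1) → K)} (hT : ∀ p ∈ U, projLinear K W ⊆ tangentSpace K Z p)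
    {v : Fin (n + 1) → K} (hv : v ∈ W) {f : MvPolynomial (Fin (n + 1)) K} {d : ℕ}
    (hf : f.IsHomogeneous d) (hfZ : ∀ x ∈ Z, eval x.rep f = 0) :
    ∀ x ∈ Z, eval x.rep (dirDeriv v f) = 0 := by
  refine fun x hx => closure_minimal (fun p hp => ?_)
    (isClosed_zeroLocus (isHomogeneous_dirDeriv v hf)) (hU hx)
  rw [Set.mem_ofPred_eq, eval_dirDeriv]
  by_cases h0 : v = 0
  · simp [h0]
  have h := hT p hp ((mk_mem_projLinear W h0).2 hv) f d hf hfZ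
  obtain ⟨a, ha⟩ := Projectivization.exists_smul_eq_mk_rep K v h0
  rw [← ha] at h
  have h' : (a : K) * ∑ i, eval p.rep (pderiv i f) * v i = 0 := by
    rw [← h, Finset.mul_sum]
    exact Finset.sum_congr rfl fun i _ => by
      simp only [Units.smul_def, Pi.smul_apply, smul_eq_mul]; ring
  exact (mul_eq_zero.1 h').resolve_left a.ne_zero

lemma restrictLine_eq_zero_of_tangent [CharZero K] {Z U : Set (Pn K n)} (hU : Z ⊆ closure U)
    {W : Submodule K (Fin (n + 1) → K)} (hT : ∀ p ∈ U, projLinear K W ⊆ tangentSpace K Z p)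
    {v : Fin (n + 1) → K} (hv : v ∈ W) {x : Pn K n} (hx : x ∈ Z)
    {f : MvPolynomial (Fin (n + 1)) K} {d : ℕ}
    (hf : f.IsHomogeneous d) (hfZ : ∀ x ∈ Z, eval x.rep f = 0) :
    restrictLine x.rep v f = 0 := by
  induction d generalizing f with
  | zero =>
    obtain ⟨r, rfl⟩ : ∃ r, f = C r :=
      ⟨_, totalDegree_eq_zero_iff_eq_C.1 ((totalDegree_zero_iff_isHomogeneous _).2 hf)⟩
    have hr : r = 0 := by simpa using hfZ x hx
    simp [hr]
  | succ d ih =>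
    have hD := ih (isHomogeneous_dirDeriv v hf) (eval_dirDeriv_eq_zero hU hT hv hf hfZ)
    rw [← derivative_restrictLine, Polynomial.derivative_eq_zero] at hD
    obtain ⟨r, hr⟩ := Polynomial.natDegree_eq_zero.1 hD
    have h0 := eval_restrictLine x.rep v f 0
    rw [zero_smul, add_zero, hfZ x hx, ← hr, Polynomial.eval_C] at h0
    rw [← hr, h0, map_zero]

/-- The affine cone over `Z` contains the span of each of its points with `W`. -/
lemma eval_smul_add_eq_zero_of_tangent [CharZero K] {Z U : Set (Pn K n)} (hU : Z ⊆ closure U)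
    {W : Submodule K (Fin (n + 1) → K)} (hT : ∀ p ∈ U, projLinear K W ⊆ tangentSpace K Z p)
    {v : Fin (n + 1) → K} (hv : v ∈ W) {x : Pn K n} (hx : x ∈ Z)
    {f : MvPolynomial (Fin (n + 1)) K} {d : ℕ}
    (hf : f.IsHomogeneous d) (hfZ : ∀ x ∈ Z, eval x.rep f = 0) (s : K) :
    eval (v + s • x.rep) f = 0 := by
  suffices h : restrictLine v x.rep f * Polynomial.X = 0 by
    rw [← eval_restrictLine, (mul_eq_zero.1 h).resolve_right Polynomial.X_ne_zero]
    simp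
  refine Polynomial.funext fun s => ?_
  by_cases hs : s = 0
  · simp [hs]
  have h := eval_restrictLine x.rep v f s⁻¹
  rw [restrictLine_eq_zero_of_tangent hU hT hv hx hf hfZ, Polynomial.eval_zero] at h
  have hvs : v + s • x.rep = s • (x.rep + s⁻¹ • v) := by
    rw [smul_add, smul_inv_smul₀ hs, add_comm v]
  rw [Polynomial.eval_mul, eval_restrictLine, hvs, eval_smul_of_isHomogeneous hf, ← h]
  simp

lemma projLinear_sup_span_subset_of_tangent [CharZero K] {Z U : Set (Pn K n)} (hZ : IsClosed Z)
    (hU : Z ⊆ closure U) {W : Submodule K (Fin (n + 1) → K)}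
    (hT : ∀ p ∈ U, projLinear K W ⊆ tangentSpace K Z p) {x : Pn K n} (hx : x ∈ Z) :
    projLinear K (W ⊔ K ∙ x.rep) ⊆ Z := by
  intro y hy
  by_contra hyZ
  obtain ⟨f, d, hf, hfZ, hfy⟩ := exists_isHomogeneous_of_notMem hZ hyZ
  obtain ⟨v, hv, u, hu, hvu⟩ := Submodule.mem_sup.1 (show y.rep ∈ W ⊔ K ∙ x.rep from hy)
  obtain ⟨s, rfl⟩ := Submodule.mem_span_singleton.1 hu
  rw [← hvu] at hfy
  exact hfy (eval_smul_add_eq_zero_of_tangent hU hT hv hx hf hfZ s)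

end Tangent

end ProjectiveZariski

open ProjectiveZariski


/-- **Trisecant-lemma paper, Proposition 1.** Let `X ⊆ ℙⁿ` be an irreducible closed variety of
dimension `k`. If a fixed `(k-1)`-dimensional projective linear subspace `L` (i.e.
`L = projLinear W` with `finrank W = k`) is contained in the embedded tangent space `T_p(X)`
for all `p` in a dense open subset of `X`, then `X` is a `k`-dimensional projective linear
subspace containing `L`. -/
theorem linear_of_tangent_contains_pencil
    (K : Type) [Field K] [IsAlgClosed K] [CharZero K]
    (n k : ℕ) (X : Set (Pn K n)) (hXcl : IsClosed X) (hXirr : IsIrreducible X)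
    (hXdim : sdim X = (k : WithBot ℕ∞))
    (L : Set (Pn K n))
    (hL : ∃ W : Submodule K (Fin (n + 1) → K), Module.finrank K W = k ∧ L = projLinear K W)
    (hTan : ∃ U : Set (Pn K n), IsDenseOpenIn U X ∧ ∀ p ∈ U, L ⊆ tangentSpace K X p) :
    (∃ W : Submodule K (Fin (n + 1) → K), Module.finrank K W = k + 1 ∧ X = projLinear K W)
      ∧ L ⊆ X := by
  obtain ⟨W, hW, rfl⟩ := hL
  obtain ⟨U, ⟨-, -, hU⟩, hT⟩ := hTan
  have hsub {x : Pn K n} (hx : x ∈ X) := projLinear_sup_span_subset_of_tangent hXcl hU hT hx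
  have hLX : projLinear K W ⊆ X := by
    obtain ⟨x, hx⟩ := hXirr.nonempty
    exact (projLinear_le_iff.2 le_sup_left).trans (hsub hx)
  refine ⟨?_, hLX⟩
  let Z : IrreducibleCloseds (Pn K n) := ⟨X, hXirr, hXcl⟩
  have hZ : height Z = k := by
    have h := (sdim_eq_height Z).symm.trans hXdim
    exact WithBot.coe_injective h
  obtain ⟨x, hxX, hxW⟩ : ∃ x ∈ X, x.rep ∉ W := by
    by_contra! hall
    obtain ⟨x, hx⟩ := hXirr.nonempty
    have hbot : W ≠ ⊥ := W.ne_bot_iff.2 ⟨x.rep, hall x hx, x.rep_nonzero⟩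
    obtain ⟨m, rfl⟩ : ∃ m, k = m + 1 := Nat.exists_eq_succ_of_ne_zero fun hk =>
      hbot (Submodule.finrank_eq_zero.1 (hW.trans hk))
    have hXW : Z = linearIrreducibleCloseds W hbot :=
      IrreducibleCloseds.ext (Set.Subset.antisymm hall hLX)
    rw [hXW, height_linearIrreducibleCloseds W hbot hW] at hZ
    exact absurd (Nat.cast_injective hZ) (by omega)
  have hfin : Module.finrank K (W ⊔ K ∙ x.rep : Submodule K _) = k + 1 := by
    rw [Submodule.finrank_sup_span_singleton hxW, hW]
  refine ⟨W ⊔ K ∙ x.rep, hfin, ?_⟩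
  have hbot : W ⊔ K ∙ x.rep ≠ ⊥ := fun h => by rw [h, finrank_bot] at hfin; omega
  have hle : linearIrreducibleCloseds _ hbot ≤ Z := hsub hxX
  have heq := hle.eq_or_lt.resolve_right fun hlt => by
    have h := height_add_one_le hlt
    rw [hZ, height_linearIrreducibleCloseds _ hbot hfin] at h
    exact absurd (show k + 1 ≤ k by exact_mod_cast h) (by omega)
  exact (congrArg (fun Y : IrreducibleCloseds (Pn K n) => (Y : Set (Pn K n))) heq).symm
end

section
/- Let n be an odd natural number and k = (n−1)/2. Let Y₁ and Y₂ be two distinct irreducible closed subvarieties of ℙⁿ over an algebraically closed field of characteristic zero, each of dimension k, and let S be the joining component of J(Y₁,Y₂), which has dimension n − 1. If there exists a third irreducible closed variety Y ⊆ ℙⁿ of dimension k, distinct from Y₁ and Y₂, such that S ⊆ Δ(Y), then Y₁, Y₂ and Y all lie in one and the same (k+1)-dimensional linear subspace of ℙⁿ, which equals the union of the lines belonging to S. -/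
/-!
Common framework: projective space over a field `K` with its Zariski topology,
lines, the Grassmannian `𝔾(1,n)` of lines (with the quotient Zariski topology
coming from the Stiefel-style parametrization by pairs of independent vectors),
the incidence variety `Δ(X)`, dimension of a subvariety as the topological Krull
dimension of the corresponding subspace, irreducible components, dense open
subsets, embedded projective tangent spaces, joins and (tri)secant varieties.
-/

open MvPolynomial
open scoped LinearAlgebra.Projectivization

namespace JoinCone

theorem exists_derivation_of_isTranscendenceBasis {K L : Type} [Field K] [Field L] [Algebra K L]
    [CharZero K] {ι : Type} {x : ι → L}
    (hx : IsTranscendenceBasis K x) (φ : ι → L) :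
    ∃ D : Derivation K L L, ∀ i, D (x i) = φ i := by
  let _ : Algebra (MvPolynomial ι K) L := (aeval x).toAlgebra
  have hinj : Function.Injective (algebraMap (MvPolynomial ι K) L) := hx.1
  have : IsScalarTower K (MvPolynomial ι K) L := IsScalarTower.of_algHom (aeval x)
  have : FaithfulSMul (MvPolynomial ι K) L := (faithfulSMul_iff_algebraMap_injective _ _).2 hinj
  let _ : Algebra (FractionRing (MvPolynomial ι K)) L := FractionRing.liftAlgebra _ _
  have : Algebra.IsAlgebraic (MvPolynomial ι K) L := by
    have h2 := hx.isAlgebraic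
    have h3 : IsTranscendenceBasis K (X : ι → MvPolynomial ι K) := .mvPolynomial ι K
    rw [Algebra.adjoin_range_eq_range_aeval] at h2
    refine ⟨fun a => ?_⟩
    exact (h2.isAlgebraic a).of_ringHom_of_comp_eq
        (RingEquiv.ofBijective ((aeval (R := K) x).rangeRestrict.toRingHom)
            ⟨fun a b h => hinj (congrArg Subtype.val h), AlgHom.rangeRestrict_surjective _⟩)
                (RingHom.id L) (RingEquiv.surjective _) (fun _ _ h => h) rfl
  have : Algebra.IsAlgebraic (FractionRing (MvPolynomial ι K)) L := 
    (IsFractionRing.comap_isAlgebraic_iff (A := MvPolynomial ι K)).1 this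
  have : CharZero (FractionRing (MvPolynomial ι K)) := by infer_instance
  have : Algebra.FormallyEtale (MvPolynomial ι K) (FractionRing (MvPolynomial ι K)) :=
    Algebra.FormallyEtale.of_isLocalization (nonZeroDivisors (MvPolynomial ι K))
  have : Algebra.FormallyEtale (FractionRing (MvPolynomial ι K)) L :=
      Algebra.FormallyEtale.of_isSeparable _ _
  have : Algebra.FormallyEtale (MvPolynomial ι K) L := Algebra.FormallyEtale.comp _
      (FractionRing (MvPolynomial ι K)) _
  let D0 : Derivation K (MvPolynomial ι K) L := mkDerivation K φ
  have hb := KaehlerDifferential.isBaseChange_of_formallyEtale K (MvPolynomial ι K) L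
  refine ⟨(hb.lift D0.liftKaehlerDifferential).compDer (KaehlerDifferential.D K L), fun i => ?_⟩
  have := hb.lift_eq D0.liftKaehlerDifferential (KaehlerDifferential.D _ _ (X i))
  rw [KaehlerDifferential.map_D, Derivation.liftKaehlerDifferential_comp_D, mkDerivation_X,
    show algebraMap (MvPolynomial ι K) L (X i) = x i from aeval_X x i] at this
  exact this

theorem derivation_eq_zero_of_isAlgebraic_adjoin {K L : Type} [Field K] [Field L] [Algebra K L]
    [CharZero K] {B : Set L}
    (D : Derivation K L L) (h : ∀ b ∈ B, D b = 0) {x : L}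
    (hx : IsAlgebraic (Algebra.adjoin K B) x) :
    D x = 0 := by
  have hE : ∀ a ∈ IntermediateField.adjoin K B, D a = 0 := by
    intro a ha
    induction ha using IntermediateField.adjoin_induction with
    | mem a ha => exact h a ha
    | algebraMap a => exact D.map_algebraMap a
    | add a b _ _ ha hb => rw [map_add, ha, hb, add_zero]
    | inv a _ ha => rw [Derivation.leibniz_inv, ha, smul_zero]
    | mul a b _ _ ha hb => rw [Derivation.leibniz, ha, hb, smul_zero, smul_zero, add_zero]
  let D' : Derivation (IntermediateField.adjoin K B) L L := Derivation.mk'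
    { D.toLinearMap.toAddMonoidHom with
      map_smul' := fun s a => by
        change D (s.1 * a) = s.1 * D a
        rw [Derivation.leibniz, hE s.1 s.2]; simp }
    (fun a b => D.leibniz a b)
  have hx' : IsAlgebraic (IntermediateField.adjoin K B) x := by
    have hle := IntermediateField.algebra_adjoin_le_adjoin K B
    let _ : Algebra (Algebra.adjoin K B) (IntermediateField.adjoin K B) :=
      (Subalgebra.inclusion hle).toRingHom.toAlgebra
    have : IsScalarTower (Algebra.adjoin K B) (IntermediateField.adjoin K B) L :=
      IsScalarTower.of_algebraMap_eq (congrFun rfl)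
    exact hx.extendScalars (Subalgebra.inclusion_injective hle)
  have : CharZero (IntermediateField.adjoin K B) := inferInstance
  have h0 := D'.map_aeval (minpoly (IntermediateField.adjoin K B) x) x
  rw [minpoly.aeval, map_zero] at h0
  have hs : (minpoly (IntermediateField.adjoin K B) x).Separable :=
    (minpoly.irreducible hx'.isIntegral).separable
  exact (smul_eq_zero.1 h0.symm).resolve_left (hs.aeval_derivative_ne_zero (minpoly.aeval _ _))

/-- The dimension of the subscheme cut out by an ideal: the transcendence degree of the quotient. -/
noncomputable def idim {K : Type} [Field K] {σ : Type} (P : Ideal (MvPolynomial σ K)) : ℕ :=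
  Cardinal.toNat (Algebra.trdeg K (MvPolynomial σ K ⧸ P))

theorem cast_idim {K : Type} [Field K] {σ : Type} [Finite σ] (P : Ideal (MvPolynomial σ K)) :
    (idim P : Cardinal) = Algebra.trdeg K (MvPolynomial σ K ⧸ P) := 
  Cardinal.cast_toNat_of_lt_aleph0 (trdeg_lt_aleph0_of_finiteType)

theorem idim_lt {K : Type} [Field K] {σ : Type} [Finite σ] {P Q : Ideal (MvPolynomial σ K)}
    [P.IsPrime] [Q.IsPrime] (h : P < Q) : idim Q < idim P := by
  obtain ⟨t, ht⟩ := exists_isTranscendenceBasis K (MvPolynomial σ K ⧸ Q)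
  have hcard := ht.cardinalMk_eq_trdeg
  let f : (MvPolynomial σ K ⧸ P) →ₐ[K] (MvPolynomial σ K ⧸ Q) := Ideal.Quotient.factorₐ K h.le
  have hf : Function.Surjective f := Ideal.Quotient.factor_surjective h.le
  choose x hx using fun i : t => hf i.1
  have hxi : AlgebraicIndependent K x := by
    have : AlgebraicIndependent K (f ∘ x) := by
      have : f ∘ x = Subtype.val := funext hx
      rw [this]; exact ht.1
    exact this.of_comp f
  by_contra hlt
  have hle : Algebra.trdeg K (MvPolynomial σ K ⧸ P) ≤ Cardinal.mk t := by
    rw [hcard, ← cast_idim, ← cast_idim]; exact_mod_cast not_lt.1 hlt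
  have hfin : Finite t := by
    rw [← Cardinal.lt_aleph0_iff_finite, hcard]; exact trdeg_lt_aleph0_of_finiteType
  have hb := hxi.isTranscendenceBasis_of_trdeg_le_of_finite hle
  have halg := hb.isAlgebraic
  obtain ⟨g, hgQ, hgP⟩ := Set.exists_of_ssubset h
  have hg0 : Ideal.Quotient.mk P g ≠ 0 := by rwa [Ne, Ideal.Quotient.eq_zero_iff_mem]
  obtain ⟨r, hr0, hr⟩ := (halg.isAlgebraic (Ideal.Quotient.mk P g)).exists_nonzero_dvd
    (mem_nonZeroDivisors_of_ne_zero hg0)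
  have hfg : f (Ideal.Quotient.mk P g) = 0 := Ideal.Quotient.eq_zero_iff_mem.2 hgQ
  have hfr : f r.1 = 0 := by
    obtain ⟨c, hc⟩ := hr
    change r.1 = _ at hc
    rw [hc, map_mul, hfg, zero_mul]
  obtain ⟨G, hG⟩ : ∃ G : MvPolynomial t K, aeval x G = r.1 := by
    have hadj : ∀ w ∈ Algebra.adjoin K (Set.range x), ∃ G : MvPolynomial t K, aeval x G = w := by
      intro w hw
      rwa [Algebra.adjoin_range_eq_range_aeval] at hw
    exact hadj r.1 r.2
  apply hr0
  have : aeval (Subtype.val : t → _) G = 0 := by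
    rw [← hfr, ← hG]
    have := congrArg (fun v => aeval v G) (funext hx : f ∘ x = Subtype.val)
    rw [← this]
    exact (MvPolynomial.comp_aeval_apply x f G).symm
  have hG0 : G = 0 := ht.1 (by rw [this, map_zero])
  exact Subtype.ext (by rw [← hG, hG0, map_zero]; rfl)

theorem idim_le {K : Type} [Field K] {σ : Type} [Finite σ] {P Q : Ideal (MvPolynomial σ K)}
    [P.IsPrime] [Q.IsPrime] (h : P ≤ Q) : idim Q ≤ idim P := by
  rcases h.eq_or_lt with rfl | h
  · rfl
  · exact (idim_lt h).le

theorem eq_of_idim_le {K : Type} [Field K] {σ : Type} [Finite σ] {P Q : Ideal (MvPolynomial σ K)}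
    [P.IsPrime] [Q.IsPrime] (h : P ≤ Q) (h' : idim P ≤ idim Q) : P = Q := by
  rcases h.eq_or_lt with h | h
  · exact h
  · exact absurd (idim_lt h) (by omega)

theorem algebraicIndependent_image_of_isTranscendenceBasis {K L A : Type} [Field K] [Field L]
    [Algebra K L] [CommRing A] [IsDomain A]
    [Algebra K A] (f : A →ₐ[K] L) (hf : Function.Injective f) {t : Set A}
    (ht : IsTranscendenceBasis K ((↑) : t → A)) :
    AlgebraicIndependent K ((↑) : (f '' t) → L) ∧
      ∀ a, IsAlgebraic (Algebra.adjoin K (f '' t)) (f a) := by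
  constructor
  · have := (ht.1.map' (f := f) hf).to_subtype_range
    rwa [Set.range_comp, Subtype.range_coe] at this
  · intro a
    have halg := ht.isAlgebraic.isAlgebraic a
    rw [Subtype.range_coe] at halg
    obtain ⟨p, hp0, hp⟩ := halg
    have hm : ∀ a : Algebra.adjoin K t, f a.1 ∈ Algebra.adjoin K (f '' t) := by
      intro a
      rw [← AlgHom.map_adjoin]
      exact ⟨a.1, a.2, rfl⟩
    let g : Algebra.adjoin K t →+* Algebra.adjoin K (f '' t) :=
      ((f.comp (Algebra.adjoin K t).val).codRestrict _ hm).toRingHom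
    have hg : Function.Injective g := fun a b h => Subtype.ext (hf (congrArg Subtype.val h))
    refine ⟨p.map g, (Polynomial.map_ne_zero_iff hg).2 hp0, ?_⟩
    have h2 := congrArg f hp
    rw [Polynomial.aeval_def, map_zero] at h2
    rw [Polynomial.aeval_def, Polynomial.eval₂_map, ← h2]
    exact (Polynomial.hom_eval₂ p _ (f : A →+* L) a).symm

theorem exists_basis_of_point {K L : Type} [Field K] [Field L] [Algebra K L] {σ : Type} [Finite σ]
    (z : σ → L) : ∃ B : Set L, B ⊆ Set.range z ∧ B.Finite ∧ AlgebraicIndependent K ((↑) : B → L) ∧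
      (∀ i, IsAlgebraic (Algebra.adjoin K B) (z i)) ∧
      B.ncard = idim (RingHom.ker (aeval (R := K) z)) := by
  have hpr : (RingHom.ker (aeval (R := K) z)).IsPrime := RingHom.ker_isPrime _
  have hf := Ideal.kerLiftAlg_injective (aeval (R := K) z)
  set f := Ideal.kerLiftAlg (aeval (R := K) z)
  let z' : σ → MvPolynomial σ K ⧸ RingHom.ker (aeval (R := K) z) := fun i => Ideal.Quotient.mk _
      (X i)
  have hfz : ∀ i, f (z' i) = z i := fun i => by
    rw [Ideal.kerLiftAlg_mk]; exact aeval_X z i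
  have htop : Algebra.adjoin K (Set.range z') = ⊤ := by
    rw [Algebra.adjoin_range_eq_range_aeval, AlgHom.range_eq_top]
    intro a
    obtain ⟨G, rfl⟩ := Ideal.Quotient.mk_surjective a
    refine ⟨G, ?_⟩
    have : aeval z' = Ideal.Quotient.mkₐ K (RingHom.ker (aeval (R := K) z)) := by
      ext i; simp [z']
    rw [this]; rfl
  have : Algebra.IsAlgebraic (Algebra.adjoin K (Set.range z'))
      (MvPolynomial σ K ⧸ RingHom.ker (aeval (R := K) z)) := by
    rw [htop]
    exact ⟨fun a => isAlgebraic_algebraMap (⟨a, trivial⟩ : (⊤ : Subalgebra K _))⟩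
  obtain ⟨t, hts, ht⟩ := exists_isTranscendenceBasis_subset (R := K) (Set.range z')
  have htfin : t.Finite := (Set.finite_range z').subset hts
  obtain ⟨h1, h2⟩ := algebraicIndependent_image_of_isTranscendenceBasis f hf ht
  refine ⟨f '' t, ?_, htfin.image _, h1, fun i => hfz i ▸ h2 (z' i), ?_⟩
  · rintro _ ⟨_, h, rfl⟩
    obtain ⟨i, rfl⟩ := hts h
    exact ⟨i, (hfz i).symm⟩
  · rw [Set.ncard_image_of_injective _ hf, ← Nat.card_coe_set_eq, Nat.card, ht.cardinalMk_eq_trdeg,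
      idim]

theorem exists_derivation_of_algebraicIndependent {K L : Type} [Field K] [Field L] [Algebra K L]
    [CharZero K] {B : Set L}
    (hB : AlgebraicIndependent K ((↑) : B → L)) (φ : L → L) :
    ∃ D : Derivation K L L, ∀ b ∈ B, D b = φ b := by
  have : FaithfulSMul K L := (faithfulSMul_iff_algebraMap_injective K L).2
      (algebraMap K L).injective
  obtain ⟨t, hBt, ht⟩ := exists_isTranscendenceBasis_superset hB
  obtain ⟨D, hD⟩ := exists_derivation_of_isTranscendenceBasis ht (fun i => φ i)
  exact ⟨D, fun b hb => hD ⟨b, hBt hb⟩⟩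

/-- The `L`-span of all derivatives of the point `z`: the tangent space at a generic point. -/
noncomputable def derSpan (K : Type) {L : Type} [Field K] [Field L] [Algebra K L] {σ : Type}
    (z : σ → L) :
    Submodule L (σ → L) where
  carrier := {v | ∃ D : Derivation K L L, ∀ i, D (z i) = v i}
  add_mem' := by
    rintro _ _ ⟨D, hD⟩ ⟨E, hE⟩
    exact ⟨D + E, fun i => by simp [hD, hE]⟩
  zero_mem' := ⟨0, fun i => by simp⟩
  smul_mem' := by
    rintro c _ ⟨D, hD⟩
    exact ⟨c • D, fun i => by simp [hD]⟩

theorem finrank_derSpan {K L : Type} [Field K] [Field L] [Algebra K L] [CharZero K] {σ : Type}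
    [Finite σ] (z : σ → L) :
    Module.finrank L (derSpan K z) = idim (RingHom.ker (aeval (R := K) z)) := by
  obtain ⟨B, hBz, hfin, hind, halg, hcard⟩ := exists_basis_of_point (K := K) z
  have := hfin.fintype
  choose i hi using fun b : B => hBz b.2
  let e : derSpan K z →ₗ[L] (B → L) := (LinearMap.funLeft L L i).comp (derSpan K z).subtype
  have he : Function.Bijective e := by
    constructor
    · rw [← LinearMap.ker_eq_bot, LinearMap.ker_eq_bot']
      rintro ⟨v, D, hD⟩ hv
      refine Subtype.ext (funext fun j => ?_)
      have h0 : ∀ b ∈ B, D b = 0 := fun b hb => by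
        have := congrFun hv ⟨b, hb⟩
        change v (i ⟨b, hb⟩) = 0 at this
        rwa [← hD, hi] at this
      change v j = 0
      rw [← hD j]
      exact derivation_eq_zero_of_isAlgebraic_adjoin D h0 (halg j)
    · intro φ
      classical
      obtain ⟨D, hD⟩ := exists_derivation_of_algebraicIndependent hind
          (fun b => if h : b ∈ B then φ ⟨b, h⟩ else 0)
      refine ⟨⟨fun j => D (z j), D, fun _ => rfl⟩, funext fun b => ?_⟩
      change D (z (i b)) = φ b
      rw [hi, hD b.1 b.2, dif_pos b.2]
  rw [(LinearEquiv.ofBijective e he).finrank_eq, Module.finrank_fintype_fun_eq_card, ← hcard,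
    ← Nat.card_eq_fintype_card, Nat.card_coe_set_eq]

theorem exists_derivation_of_algebraicIndependent_family {K L : Type} [Field K] [Field L]
    [Algebra K L] [CharZero K]
    {ι : Type} {x : ι → L} (hx : AlgebraicIndependent K x) (φ : ι → L) :
    ∃ D : Derivation K L L, ∀ i, D (x i) = φ i := by
  obtain ⟨D, hD⟩ := exists_derivation_of_algebraicIndependent hx.to_subtype_range
      (Function.extend x φ 0)
  exact ⟨D, fun i => by rw [hD _ ⟨i, rfl⟩, hx.injective.extend_apply]⟩

/-- The set of pairs, as points of a product affine space. -/
def pairSet {K σ τ : Type} (A : Set (σ → K)) (B : Set (τ → K)) : Set (σ ⊕ τ → K) :=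
  {v | ∃ a ∈ A, ∃ b ∈ B, v = Sum.elim a b}

/-- Substituting constants in the left variables. -/
noncomputable def fixLeft {K σ τ : Type} [Field K] (a : σ → K) :
    MvPolynomial (σ ⊕ τ) K →ₐ[K] MvPolynomial τ K :=
  bind₁ (Sum.elim (fun i => C (a i)) X)

/-- Substituting constants in the right variables. -/
noncomputable def fixRight {K σ τ : Type} [Field K] (b : τ → K) :
    MvPolynomial (σ ⊕ τ) K →ₐ[K] MvPolynomial σ K :=
  bind₁ (Sum.elim X (fun i => C (b i)))

theorem aeval_fixLeft {K σ τ S : Type} [Field K] [CommRing S] [Algebra K S] (a : σ → K) (b : τ → S)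
    (G : MvPolynomial (σ ⊕ τ) K) :
    aeval b (fixLeft a G) = aeval (Sum.elim (fun i => algebraMap K S (a i)) b) G := by
  rw [fixLeft, aeval_bind₁]
  congr 2
  ext (i | i) <;> simp

theorem aeval_fixRight {K σ τ S : Type} [Field K] [CommRing S] [Algebra K S] (a : σ → S) (b : τ → K)
    (G : MvPolynomial (σ ⊕ τ) K) :
    aeval a (fixRight b G) = aeval (Sum.elim a (fun i => algebraMap K S (b i))) G := by
  rw [fixRight, aeval_bind₁]
  congr 2
  ext (i | i) <;> simp

theorem nonempty_of_isPrime {K σ : Type} [Field K] {A : Set (σ → K)}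
    (hA : (vanishingIdeal K A).IsPrime) : A.Nonempty := by
  by_contra h
  rw [Set.not_nonempty_iff_eq_empty] at h
  exact hA.ne_top (by rw [h, vanishingIdeal_empty])

theorem isPrime_pairSet {K σ τ : Type} [Field K] {A : Set (σ → K)} {B : Set (τ → K)}
    (hA : (vanishingIdeal K A).IsPrime) (hB : (vanishingIdeal K B).IsPrime) :
    (vanishingIdeal K (pairSet A B)).IsPrime := by
  refine ⟨?_, ?_⟩
  · obtain ⟨a, ha⟩ := nonempty_of_isPrime hA
    obtain ⟨b, hb⟩ := nonempty_of_isPrime hB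
    rw [Ne, Ideal.eq_top_iff_one]
    intro h
    have := h _ ⟨a, ha, b, hb, rfl⟩
    simp at this
  · intro G H hGH
    by_contra! hcon
    obtain ⟨hG, hH⟩ := hcon
    simp only [mem_vanishingIdeal_iff, not_forall] at hG hH
    obtain ⟨_, ⟨a₀, ha₀, b₀, hb₀, rfl⟩, hG⟩ := hG
    obtain ⟨_, ⟨a₁, ha₁, b₁, hb₁, rfl⟩, hH⟩ := hH
    have key : fixRight b₀ G * fixRight b₁ H ∈ vanishingIdeal K A := by
      intro a ha
      rw [map_mul, aeval_fixRight, aeval_fixRight]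
      have : fixLeft a G * fixLeft a H ∈ vanishingIdeal K B := by
        intro b hb
        rw [← map_mul, aeval_fixLeft]
        exact hGH _ ⟨a, ha, b, hb, rfl⟩
      rcases hB.mem_or_mem this with h | h
      · have := h b₀ hb₀
        rw [aeval_fixLeft] at this
        exact mul_eq_zero_of_left this _
      · have := h b₁ hb₁
        rw [aeval_fixLeft] at this
        exact mul_eq_zero_of_right _ this
    rcases hA.mem_or_mem key with h | h
    · have := h a₀ ha₀
      rw [aeval_fixRight] at this
      exact hG this
    · have := h a₁ ha₁
      rw [aeval_fixRight] at this
      exact hH this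

/-- `(p, q)` is a generic point of `A × B`. -/
def IsGenericPair {K L σ τ : Type} [Field K] [Field L] [Algebra K L] (A : Set (σ → K))
    (B : Set (τ → K))
    (p : σ → L) (q : τ → L) : Prop :=
  ∀ G : MvPolynomial (σ ⊕ τ) K, aeval (Sum.elim p q) G = 0 ↔ G ∈ vanishingIdeal K (pairSet A B)

namespace IsGenericPair

variable {K L σ τ : Type} [Field K] [Field L] [Algebra K L] {A : Set (σ → K)} {B : Set (τ → K)}
    {p : σ → L} {q : τ → L}

theorem aeval_left (h : IsGenericPair A B p q) (hB : B.Nonempty) (f : MvPolynomial σ K) :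
    aeval p f = 0 ↔ f ∈ vanishingIdeal K A := by
  have := h (rename Sum.inl f)
  rw [aeval_rename, Sum.elim_comp_inl] at this
  rw [this]
  constructor
  · intro h a ha
    obtain ⟨b, hb⟩ := hB
    simpa [aeval_rename] using h _ ⟨a, ha, b, hb, rfl⟩
  · rintro h _ ⟨a, ha, b, hb, rfl⟩
    simpa [aeval_rename] using h a ha

theorem aeval_right (h : IsGenericPair A B p q) (hA : A.Nonempty) (f : MvPolynomial τ K) :
    aeval q f = 0 ↔ f ∈ vanishingIdeal K B := by
  have := h (rename Sum.inr f)
  rw [aeval_rename, Sum.elim_comp_inr] at this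
  rw [this]
  constructor
  · intro h b hb
    obtain ⟨a, ha⟩ := hA
    simpa [aeval_rename] using h _ ⟨a, ha, b, hb, rfl⟩
  · rintro h _ ⟨a, ha, b, hb, rfl⟩
    simpa [aeval_rename] using h b hb

theorem sumElim_indep [Infinite K] (h : IsGenericPair A B p q) (hA : A.Nonempty) (hB : B.Nonempty)
    {ι κ : Type} {u : ι → σ} {v : κ → τ} (hu : AlgebraicIndependent K (p ∘ u))
    (hv : AlgebraicIndependent K (q ∘ v)) :
    AlgebraicIndependent K (Sum.elim (p ∘ u) (q ∘ v)) := by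
  rw [algebraicIndependent_iff] at hu hv ⊢
  intro G hG
  have h1 : rename (Sum.map u v) G ∈ vanishingIdeal K (pairSet A B) := by
    rw [← h, aeval_rename, Sum.elim_comp_map, hG]
  have h2 : ∀ a ∈ A, fixLeft (a ∘ u) G = 0 := by
    intro a ha
    apply hv
    rw [← aeval_rename, h.aeval_right hA]
    intro b hb
    have := h1 _ ⟨a, ha, b, hb, rfl⟩
    rw [aeval_rename, Sum.elim_comp_map] at this
    rw [aeval_rename, aeval_fixLeft]
    exact this
  have h3 : ∀ c, fixRight c G = 0 := by
    intro c
    apply hu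
    rw [← aeval_rename, h.aeval_left hB]
    intro a ha
    rw [aeval_rename, aeval_fixRight]
    have := congrArg (aeval c) (h2 a ha)
    rw [aeval_fixLeft, map_zero] at this
    exact this
  apply MvPolynomial.funext
  intro w
  have := congrArg (aeval (w ∘ Sum.inl)) (h3 (w ∘ Sum.inr))
  rw [aeval_fixRight, map_zero] at this
  have hw : (Sum.elim (w ∘ Sum.inl) fun i => algebraMap K K ((w ∘ Sum.inr) i)) = w :=
    Sum.elim_comp_inl_inr w
  rw [hw] at this
  rw [map_zero, ← this, ← coe_aeval_eq_eval]
  rfl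

theorem exists_derivation [CharZero K] [Finite σ] [Finite τ] (h : IsGenericPair A B p q)
    (hA : A.Nonempty) (hB : B.Nonempty) (D₁ D₂ : Derivation K L L) :
    ∃ D : Derivation K L L, (∀ i, D (p i) = D₁ (p i)) ∧ ∀ i, D (q i) = D₂ (q i) := by
  obtain ⟨S, hSp, -, hS, hSalg, -⟩ := exists_basis_of_point (K := K) p
  obtain ⟨T, hTq, -, hT, hTalg, -⟩ := exists_basis_of_point (K := K) q
  choose u hu using fun s : S => hSp s.2
  choose v hv using fun s : T => hTq s.2
  have hu' : p ∘ u = Subtype.val := _root_.funext hu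
  have hv' : q ∘ v = Subtype.val := _root_.funext hv
  have hind := h.sumElim_indep hA hB (u := u) (v := v) (hu' ▸ hS) (hv' ▸ hT)
  obtain ⟨D, hD⟩ := exists_derivation_of_algebraicIndependent_family hind
      (Sum.elim (fun s => D₁ s) (fun s => D₂ s))
  refine ⟨D, fun i => ?_, fun i => ?_⟩
  · have := derivation_eq_zero_of_isAlgebraic_adjoin (D - D₁) (fun b hb => ?_) (hSalg i)
    · simpa [sub_eq_zero] using this
    · have := hD (Sum.inl ⟨b, hb⟩)
      simp only [hu', Sum.elim_inl] at this
      simp [this]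
  · have := derivation_eq_zero_of_isAlgebraic_adjoin (D - D₂) (fun b hb => ?_) (hTalg i)
    · simpa [sub_eq_zero] using this
    · have := hD (Sum.inr ⟨b, hb⟩)
      simp only [hv', Sum.elim_inr] at this
      simp [this]

end IsGenericPair

/-- A cone: a set stable under scalar multiplication. -/
def IsCone {K σ : Type} [Field K] (A : Set (σ → K)) : Prop :=
  ∀ (c : K), ∀ a ∈ A, c • a ∈ A

theorem IsCone.zero_mem {K σ : Type} [Field K] {A : Set (σ → K)} (h : IsCone A) (hA : A.Nonempty) :
    (0 : σ → K) ∈ A := by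
  obtain ⟨a, ha⟩ := hA
  simpa using h 0 a ha

theorem exists_field_of_isPrime {K S : Type} [Field K] [CommRing S] [Algebra K S] (P : Ideal S)
    (hP : P.IsPrime) :
    ∃ (L : Type) (_ : Field L) (_ : Algebra K L) (φ : S →ₐ[K] L), ∀ g, φ g = 0 ↔ g ∈ P := by
  refine ⟨FractionRing (S ⧸ P), inferInstance, inferInstance,
    (IsScalarTower.toAlgHom K (S ⧸ P) _).comp (Ideal.Quotient.mkₐ K P), fun g => ?_⟩
  change algebraMap (S ⧸ P) (FractionRing (S ⧸ P)) (Ideal.Quotient.mk P g) = 0 ↔ _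
  rw [map_eq_zero_iff _ (IsFractionRing.injective _ _), Ideal.Quotient.eq_zero_iff_mem]

theorem exists_genericPair_with_third {K σ : Type} [Field K] {A₁ A₂ A : Set (σ → K)}
    (h₁ : (vanishingIdeal K A₁).IsPrime) (h₂ : (vanishingIdeal K A₂).IsPrime)
    (hcone : IsCone A) (hAne : A.Nonempty) (hcone₂ : IsCone A₂)
    (hA2 : ¬ vanishingIdeal K A ≤ vanishingIdeal K A₂)
    (h21 : ¬ vanishingIdeal K A₂ ≤ vanishingIdeal K A₁)
    (hline : ∀ a ∈ A₁, ∀ b ∈ A₂, LinearIndependent K ![a, b] →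
      ∃ s t : K, s • a + t • b ∈ A ∧ s • a + t • b ≠ 0) :
    ∃ (L : Type) (_ : Field L) (_ : Algebra K L) (p q : σ → L) (μ : L),
      IsGenericPair A₁ A₂ p q ∧ ∀ f ∈ vanishingIdeal K A, aeval (p + μ • q) f = 0 := by
  have hP := isPrime_pairSet h₁ h₂
  set P := vanishingIdeal K (pairSet A₁ A₂) with hPdef
  let y : σ → Polynomial (MvPolynomial (σ ⊕ σ) K) := fun i => Polynomial.C
      (X (Sum.inl i)) + Polynomial.X * Polynomial.C (X (Sum.inr i))
  let J : Ideal (Polynomial (MvPolynomial (σ ⊕ σ) K)) := Ideal.map Polynomial.C P ⊔ Ideal.map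
      (aeval y) (vanishingIdeal K A)
  let S : Submonoid (Polynomial (MvPolynomial (σ ⊕ σ) K)) := P.primeCompl.map
      (Polynomial.C : MvPolynomial (σ ⊕ σ) K →+* Polynomial (MvPolynomial (σ ⊕ σ) K))
  have hdisj : Disjoint (J : Set (Polynomial (MvPolynomial (σ ⊕ σ) K))) S := by
    rw [Set.disjoint_left]
    rintro _ hJ ⟨g, hg, rfl⟩
    obtain ⟨f₀, hf₀, hf₀'⟩ := Set.not_subset.1 hA2
    obtain ⟨f₁, hf₁, hf₁'⟩ := Set.not_subset.1 h21
    have hf₀P : rename Sum.inr f₀ ∉ P := fun h => hf₀' fun b hb => by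
      obtain ⟨a, ha⟩ := nonempty_of_isPrime h₁
      simpa [aeval_rename] using h _ ⟨a, ha, b, hb, rfl⟩
    have hf₁P : rename Sum.inl f₁ ∉ P := fun h => hf₁' fun a ha => by
      obtain ⟨b, hb⟩ := nonempty_of_isPrime h₂
      simpa [aeval_rename] using h _ ⟨a, ha, b, hb, rfl⟩
    have hprod : g * rename Sum.inr f₀ * rename Sum.inl f₁ ∉ P := fun h => by
      rcases hP.mem_or_mem h with h | h
      · rcases hP.mem_or_mem h with h | h
        · exact hg h
        · exact hf₀P h
      · exact hf₁P h
    rw [hPdef, mem_vanishingIdeal_iff] at hprod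
    push Not at hprod
    obtain ⟨_, ⟨a, ha, b, hb, rfl⟩, hab⟩ := hprod
    simp only [map_mul, aeval_rename, Sum.elim_comp_inr, Sum.elim_comp_inl, mul_ne_zero_iff] at hab
    obtain ⟨⟨hgab, hfb⟩, hfa⟩ := hab
    have hbA : b ∉ A := fun h => hfb (hf₀ b h)
    have haA : a ∉ A₂ := fun h => hfa (hf₁ a h)
    have hA0 : b ≠ 0 := by
      rintro rfl
      exact hbA (hcone.zero_mem hAne)
    have hli : LinearIndependent K ![a, b] := by
      rw [LinearIndependent.pair_iff]
      intro s t hst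
      have hs : s = 0 := by
        by_contra hs
        apply haA
        have : a = (-(s⁻¹ * t)) • b := by
          have := congrArg (fun v => s⁻¹ • v) hst
          simp only [smul_add, smul_smul, inv_mul_cancel₀ hs, one_smul, smul_zero] at this
          rw [neg_smul]; exact eq_neg_of_add_eq_zero_left this
        rw [this]; exact hcone₂ _ _ hb
      subst hs
      simpa [hA0] using hst
    obtain ⟨s, t, hst, hst0⟩ := hline a ha b hb hli
    have hs : s ≠ 0 := by
      rintro rfl
      simp only [zero_smul, zero_add] at hst hst0
      have ht : t ≠ 0 := by rintro rfl; simp at hst0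
      have := hcone t⁻¹ _ hst
      rw [smul_smul, inv_mul_cancel₀ ht, one_smul] at this
      exact hbA this
    have hsA : a + (s⁻¹ * t) • b ∈ A := by
      have := hcone s⁻¹ _ hst
      rwa [smul_add, smul_smul, smul_smul, inv_mul_cancel₀ hs, one_smul] at this
    let ev : Polynomial (MvPolynomial (σ ⊕ σ) K) →+* K :=
      Polynomial.eval₂RingHom (aeval (Sum.elim a b) : MvPolynomial (σ ⊕ σ) K →ₐ[K] K).toRingHom
          (s⁻¹ * t)
    have hev : J ≤ RingHom.ker ev := by
      refine sup_le ?_ ?_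
      · rw [Ideal.map_le_iff_le_comap]
        intro f hf
        change ev (Polynomial.C f) = 0
        simp only [ev, Polynomial.coe_eval₂RingHom, Polynomial.eval₂_C]
        exact hf _ ⟨a, ha, b, hb, rfl⟩
      · rw [Ideal.map_le_iff_le_comap]
        intro f hf
        change ev (aeval y f) = 0
        have h := hf _ hsA
        rw [← h]
        have h2 : (ev.comp (aeval y : MvPolynomial σ K →ₐ[K] Polynomial
            (MvPolynomial (σ ⊕ σ) K)).toRingHom) =
            (aeval (R := K) (a + (s⁻¹ * t) • b)).toRingHom := by
          ext i
          · simp [ev]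
          · simp [ev, y]
            ring
        exact congrArg (fun φ => φ f) h2
    have h0 : ev (Polynomial.C g) = 0 := hev hJ
    simp only [ev, Polynomial.coe_eval₂RingHom, Polynomial.eval₂_C] at h0
    exact hgab h0
  obtain ⟨𝔭, h𝔭, hJ, hd⟩ := Ideal.exists_le_prime_disjoint J S hdisj
  obtain ⟨L, _, _, φ, hφ⟩ := exists_field_of_isPrime (K := K) 𝔭 h𝔭
  let ψ : MvPolynomial (σ ⊕ σ) K →ₐ[K] L := φ.comp
      (IsScalarTower.toAlgHom K (MvPolynomial (σ ⊕ σ) K) (Polynomial (MvPolynomial (σ ⊕ σ) K)))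
  refine ⟨L, inferInstance, inferInstance, fun i => ψ (X (Sum.inl i)), fun i => ψ (X (Sum.inr i)),
    φ Polynomial.X, fun G => ?_, fun f hf => ?_⟩
  · have : aeval (Sum.elim (fun i => ψ (X (Sum.inl i))) (fun i => ψ (X (Sum.inr i)))) = ψ := by
      ext (i | i) <;> simp
    rw [this]
    change φ (Polynomial.C G) = 0 ↔ _
    rw [hφ]
    constructor
    · intro h
      by_contra hG
      exact Set.disjoint_left.1 hd h ⟨G, hG, rfl⟩
    · intro h
      exact hJ (Ideal.mem_sup_left (Ideal.mem_map_of_mem _ h))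
  · have h : φ (aeval y f) = 0 := (hφ _).2 (hJ (Ideal.mem_sup_right (Ideal.mem_map_of_mem _ hf)))
    rw [← h, comp_aeval_apply]
    congr 2
    ext i
    simp only [Pi.add_apply, Pi.smul_apply, y, map_add, map_mul, smul_eq_mul]
    rfl

/-- Pull-back of polynomial functions along a linear map. -/
noncomputable def linSub {K σ τ : Type} [Field K] [Fintype τ] [DecidableEq τ]
    (M : (τ → K) →ₗ[K] (σ → K)) : MvPolynomial σ K →ₐ[K] MvPolynomial τ K :=
  bind₁ fun i => ∑ j, C (M (Pi.single j 1) i) * X j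

theorem aeval_linSub {K σ τ : Type} [Field K] [Fintype τ] [DecidableEq τ]
    (M : (τ → K) →ₗ[K] (σ → K)) (v : τ → K) (f : MvPolynomial σ K) :
    aeval v (linSub M f) = aeval (M v) f := by
  rw [linSub, aeval_bind₁]
  congr 2
  funext i
  rw [LinearMap.pi_apply_eq_sum_univ M v]
  simp only [map_sum, map_mul, aeval_C, aeval_X, Finset.sum_apply, Pi.smul_apply, smul_eq_mul,
    Algebra.algebraMap_self_apply]
  refine Finset.sum_congr rfl fun j _ => ?_
  have hj : (Pi.single j 1 : τ → K) = fun k => if j = k then 1 else 0 := by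
    ext k
    simp [Pi.single_apply, eq_comm]
  rw [hj, mul_comm]

theorem funext_aeval {K σ : Type} [Field K] [Infinite K] {f g : MvPolynomial σ K}
    (h : ∀ v : σ → K, aeval v f = aeval v g) : f = g :=
  MvPolynomial.funext fun v => h v

theorem exists_parametrization {K σ : Type} [Field K] [Finite σ] (W : Submodule K (σ → K)) :
    ∃ M : (Fin (Module.finrank K W) → K) →ₗ[K] (σ → K), Function.Injective M ∧
      LinearMap.range M = W := by
  refine ⟨W.subtype.comp (Module.finBasis K W).equivFun.symm.toLinearMap, ?_, ?_⟩
  · exact Subtype.val_injective.comp (LinearEquiv.injective _)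
  · rw [LinearMap.range_comp, LinearEquiv.range, Submodule.map_top, Submodule.range_subtype]

theorem linSub_eq_zero_iff {K σ τ : Type} [Field K] [Infinite K] [Fintype τ] [DecidableEq τ]
    (M : (τ → K) →ₗ[K] (σ → K)) (f : MvPolynomial σ K) :
    linSub M f = 0 ↔ f ∈ vanishingIdeal K (LinearMap.range M : Set (σ → K)) := by
  constructor
  · rintro h _ ⟨v, rfl⟩
    rw [← aeval_linSub, h, map_zero]
  · intro h
    refine funext_aeval fun v => ?_
    rw [aeval_linSub, map_zero]
    exact h _ ⟨v, rfl⟩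

theorem linSub_surjective {K σ τ : Type} [Field K] [Infinite K] [Fintype σ] [DecidableEq σ]
    [Fintype τ]
    [DecidableEq τ] {M : (τ → K) →ₗ[K] (σ → K)} (hM : Function.Injective M) :
    Function.Surjective (linSub M) := by
  obtain ⟨N, hN⟩ := LinearMap.exists_leftInverse_of_injective M (LinearMap.ker_eq_bot.2 hM)
  intro f
  refine ⟨linSub N f, funext_aeval fun v => ?_⟩
  rw [aeval_linSub, aeval_linSub]
  congr 1
  exact congrArg _ (LinearMap.congr_fun hN v)

theorem isPrime_vanishingIdeal_submodule {K σ : Type} [Field K] [Infinite K] [Finite σ]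
    (W : Submodule K (σ → K)) : (vanishingIdeal K (W : Set (σ → K))).IsPrime := by
  obtain ⟨M, -, hW⟩ := exists_parametrization W
  have : vanishingIdeal K (W : Set (σ → K)) = RingHom.ker (linSub M) := by
    ext f
    rw [RingHom.mem_ker, linSub_eq_zero_iff, hW]
  rw [this]
  exact RingHom.ker_isPrime _

theorem idim_ker_of_surjective {K σ τ : Type} [Field K] [Finite τ]
    (φ : MvPolynomial σ K →ₐ[K] MvPolynomial τ K) (hφ : Function.Surjective φ)
    (P : Ideal (MvPolynomial τ K)) : idim (P.comap φ) = idim P := by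
  rw [idim, idim]
  congr 1
  have hs : Function.Surjective ((Ideal.Quotient.mkₐ K P).comp φ) :=
    (Ideal.Quotient.mkₐ_surjective K P).comp hφ
  have hk : RingHom.ker ((Ideal.Quotient.mkₐ K P).comp φ) = P.comap φ := by
    ext f
    simp [RingHom.mem_ker, Ideal.Quotient.eq_zero_iff_mem]
  rw [← hk]
  exact (Ideal.quotientKerAlgEquivOfSurjective hs).trdeg_eq

theorem idim_bot {K σ : Type} [Field K] [Finite σ] :
    idim (⊥ : Ideal (MvPolynomial σ K)) = Nat.card σ := by
  rw [idim, (AlgEquiv.quotientBot K (MvPolynomial σ K)).trdeg_eq, MvPolynomial.trdeg_of_isDomain]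
  simp [Nat.card]

theorem idim_vanishingIdeal_submodule {K σ : Type} [Field K] [Infinite K] [Finite σ]
    (W : Submodule K (σ → K)) :
    idim (vanishingIdeal K (W : Set (σ → K))) = Module.finrank K W := by
  obtain ⟨M, hM, hW⟩ := exists_parametrization W
  have := Fintype.ofFinite σ
  classical
  have hk : vanishingIdeal K (W : Set (σ → K)) = Ideal.comap (linSub M) ⊥ := by
    ext f
    rw [Ideal.mem_comap, Ideal.mem_bot, linSub_eq_zero_iff, hW]
  rw [hk, idim_ker_of_surjective _ (linSub_surjective hM), idim_bot, Nat.card_eq_fintype_card,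
    Fintype.card_fin]

/-- The set of sums of elements of `A` and `B`. -/
def sumSet {K σ : Type} [Field K] (A B : Set (σ → K)) : Set (σ → K) :=
  {v | ∃ a ∈ A, ∃ b ∈ B, v = a + b}

/-- Substitution of a sum of two families of variables. -/
noncomputable def addSub (K σ : Type) [Field K] : MvPolynomial σ K →ₐ[K] MvPolynomial (σ ⊕ σ) K :=
  bind₁ fun i => X (Sum.inl i) + X (Sum.inr i)

theorem aeval_addSub {K σ S : Type} [Field K] [CommRing S] [Algebra K S] (a b : σ → S)
    (f : MvPolynomial σ K) : aeval (Sum.elim a b) (addSub K σ f) = aeval (a + b) f := by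
  rw [addSub, aeval_bind₁]
  congr 2
  funext i
  simp

theorem vanishingIdeal_sumSet {K σ : Type} [Field K] (A B : Set (σ → K)) :
    vanishingIdeal K (sumSet A B) = (vanishingIdeal K (pairSet A B)).comap (addSub K σ) := by
  ext f
  constructor
  · rintro h _ ⟨a, ha, b, hb, rfl⟩
    rw [aeval_addSub]
    exact h _ ⟨a, ha, b, hb, rfl⟩
  · rintro h _ ⟨a, ha, b, hb, rfl⟩
    rw [← aeval_addSub]
    exact h _ ⟨a, ha, b, hb, rfl⟩

theorem isPrime_sumSet {K σ : Type} [Field K] {A B : Set (σ → K)}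
    (hA : (vanishingIdeal K A).IsPrime) (hB : (vanishingIdeal K B).IsPrime) :
    (vanishingIdeal K (sumSet A B)).IsPrime := by
  have := isPrime_pairSet hA hB
  rw [vanishingIdeal_sumSet]
  exact Ideal.IsPrime.comap _

/-- Translation of polynomials. -/
noncomputable def polyTranslate {K σ : Type} [Field K] (w : σ → K) :
    MvPolynomial σ K →ₐ[K] MvPolynomial σ K :=
  bind₁ fun i => X i + C (w i)

theorem aeval_polyTranslate {K σ : Type} [Field K] (w v : σ → K) (f : MvPolynomial σ K) :
    aeval v (polyTranslate w f) = aeval (v + w) f := by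
  rw [polyTranslate, aeval_bind₁]
  congr 2
  funext i
  simp

theorem mem_zeroLocus_vanishingIdeal_of {K σ : Type} [Field K] {A : Set (σ → K)}
    (hA : zeroLocus K (vanishingIdeal K A) = A) {a : σ → K} (ha : a ∉ A) :
    ∃ f ∈ vanishingIdeal K A, aeval a f ≠ 0 := by
  rw [← hA, mem_zeroLocus_iff] at ha
  push Not at ha
  exact ha

theorem idim_ker_add_le {K L σ : Type} [Field K] [Field L] [Algebra K L] [CharZero K] [Finite σ]
    {A B : Set (σ → K)} {p q : σ → L} (h : IsGenericPair A B p q) (hA : A.Nonempty)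
        (hB : B.Nonempty)
    {μ : L} (hμ : μ ≠ 0) :
    idim (RingHom.ker (aeval (R := K) (p + q))) ≤ idim
        (RingHom.ker (aeval (R := K) (p + μ • q))) + 1 := by
  rw [← finrank_derSpan, ← finrank_derSpan]
  have hle : derSpan K (p + q) ≤ derSpan K (p + μ • q) ⊔ Submodule.span L {q} := by
    rintro v ⟨D, hD⟩
    obtain ⟨E, hEp, hEq⟩ := h.exists_derivation hA hB D (μ⁻¹ • D)
    rw [Submodule.mem_sup]
    refine ⟨fun i => E ((p + μ • q) i), ⟨E, fun _ => rfl⟩, (-E μ) • q,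
      Submodule.smul_mem _ _ (Submodule.mem_span_singleton_self q), ?_⟩
    ext i
    rw [← hD i]
    simp only [Pi.add_apply, Pi.smul_apply, smul_eq_mul, map_add, Derivation.leibniz, hEp, hEq,
      Derivation.smul_apply]
    field_simp
    ring
  have := Fintype.ofFinite σ
  calc Module.finrank L (derSpan K (p + q)) ≤ _ := Submodule.finrank_mono hle
    _ ≤ _ := Submodule.finrank_add_le_finrank_add_finrank _ _
    _ ≤ _ := by gcongr; exact (finrank_span_le_card {q}).trans (by simp)

theorem ker_aeval_add {K L σ : Type} [Field K] [Field L] [Algebra K L]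
    {A B : Set (σ → K)} {p q : σ → L} (h : IsGenericPair A B p q) :
    RingHom.ker (aeval (R := K) (p + q)) = vanishingIdeal K (sumSet A B) := by
  ext f
  rw [vanishingIdeal_sumSet, Ideal.mem_comap, ← h, RingHom.mem_ker, aeval_addSub]

/-- If the sum set of two cones has the least possible dimension, its ideal is invariant under
translations by the first cone. -/
theorem translate_mem_of_idim_le {K σ : Type} [Field K] [Infinite K] [Finite σ] {A B : Set (σ → K)}
    (hA : (vanishingIdeal K A).IsPrime) (hB : (vanishingIdeal K B).IsPrime)
    (hAc : IsCone A) (hBcl : zeroLocus K (vanishingIdeal K B) = B) (hB0 : (0 : σ → K) ∈ B)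
    (hne : ¬ vanishingIdeal K B ≤ vanishingIdeal K A)
    (hd : idim (vanishingIdeal K (sumSet A B)) ≤ idim (vanishingIdeal K B) + 1)
    {a : σ → K} (ha : a ∈ A) {f : MvPolynomial σ K} (hf : f ∈ vanishingIdeal K (sumSet A B)) :
    polyTranslate a f ∈ vanishingIdeal K (sumSet A B) := by
  have hprime := isPrime_sumSet hA hB
  have hoff : ∀ a ∈ A, a ∉ B → polyTranslate a f ∈ vanishingIdeal K (sumSet A B) := by
    intro a ha haB
    have hl : (vanishingIdeal K
        ((Submodule.span K {a} : Submodule K (σ → K)) : Set (σ → K))).IsPrime :=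
      isPrime_vanishingIdeal_submodule _
    have hJ' := isPrime_sumSet hl hB
    have hle : vanishingIdeal K (sumSet A B) ≤
        vanishingIdeal K (sumSet ((Submodule.span K {a} : Submodule K (σ → K)) : Set (σ → K)) B) :=
            by
      apply vanishingIdeal_anti_mono
      rintro _ ⟨c, hc, b, hb, rfl⟩
      obtain ⟨s, rfl⟩ := Submodule.mem_span_singleton.1 hc
      exact ⟨_, hAc s a ha, b, hb, rfl⟩
    have hlt : vanishingIdeal K
        (sumSet ((Submodule.span K {a} : Submodule K (σ → K)) : Set (σ → K)) B)
        < vanishingIdeal K B := by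
      refine lt_of_le_of_ne ?_ ?_
      · apply vanishingIdeal_anti_mono
        intro b hb
        exact ⟨0, Submodule.zero_mem _, b, hb, (zero_add b).symm⟩
      · intro heq
        obtain ⟨g, hg, hga⟩ := mem_zeroLocus_vanishingIdeal_of hBcl haB
        rw [← heq] at hg
        exact hga (hg _ ⟨a, Submodule.mem_span_singleton_self a, 0, hB0, (add_zero a).symm⟩)
    have h1 := idim_lt hlt
    have heq := eq_of_idim_le hle (by omega)
    rw [heq] at hf ⊢
    rintro _ ⟨c, hc, b, hb, rfl⟩
    rw [aeval_polyTranslate]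
    exact hf _ ⟨c + a, Submodule.add_mem _ hc (Submodule.mem_span_singleton_self a), b, hb, by abel⟩
  obtain ⟨g, hg, hgA⟩ := Set.not_subset.1 hne
  rintro _ ⟨c, hc, b, hb, rfl⟩
  have hprod : g * polyTranslate (c + b) f ∈ vanishingIdeal K A := by
    intro a ha
    rw [map_mul, aeval_polyTranslate]
    by_cases haB : a ∈ B
    · rw [hg a haB, zero_mul]
    · have := hoff a ha haB _ ⟨c, hc, b, hb, rfl⟩
      rw [aeval_polyTranslate, add_comm] at this
      rw [this, mul_zero]
  have := (hA.mem_or_mem hprod).resolve_left hgA a ha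
  rwa [aeval_polyTranslate, add_comm, ← aeval_polyTranslate] at this

/-- A linear form, as a polynomial. -/
noncomputable def formPoly {K σ : Type} [Field K] [Fintype σ] [DecidableEq σ]
    (ℓ : Module.Dual K (σ → K)) : MvPolynomial σ K :=
  ∑ i, C (ℓ fun j => if i = j then 1 else 0) * X i

theorem aeval_formPoly {K σ : Type} [Field K] [Fintype σ] [DecidableEq σ]
    (ℓ : Module.Dual K (σ → K)) (v : σ → K) : aeval v (formPoly ℓ) = ℓ v := by
  rw [LinearMap.pi_apply_eq_sum_univ ℓ v]
  simp [formPoly, mul_comm]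

theorem aeval_formPoly_add_smul {K L σ : Type} [Field K] [Field L] [Algebra K L] [Fintype σ]
    [DecidableEq σ] (ℓ : Module.Dual K (σ → K)) (p q : σ → L) (μ : L) :
    aeval (p + μ • q) (formPoly ℓ) = aeval p (formPoly ℓ) + μ * aeval q (formPoly ℓ) := by
  simp only [formPoly, map_sum, map_mul, aeval_C, aeval_X, Pi.add_apply, Pi.smul_apply, smul_eq_mul,
    Finset.mul_sum, ← Finset.sum_add_distrib]
  exact Finset.sum_congr rfl fun i _ => by ring

theorem sumSet_comm {K σ : Type} [Field K] (A B : Set (σ → K)) : sumSet A B = sumSet B A := by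
  ext v
  constructor <;> rintro ⟨a, ha, b, hb, rfl⟩ <;> exact ⟨b, hb, a, ha, add_comm _ _⟩

theorem exists_subspace_of_idim_sumSet_le {K σ : Type} [Field K] [Infinite K] [Finite σ]
    {A₁ A₂ : Set (σ → K)} {d : ℕ}
    (h₁ : (vanishingIdeal K A₁).IsPrime) (h₂ : (vanishingIdeal K A₂).IsPrime)
    (hc₁ : IsCone A₁) (hc₂ : IsCone A₂)
    (hcl₁ : zeroLocus K (vanishingIdeal K A₁) = A₁) (hcl₂ : zeroLocus K (vanishingIdeal K A₂) = A₂)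
    (hd₁ : idim (vanishingIdeal K A₁) = d) (hd₂ : idim (vanishingIdeal K A₂) = d)
    (hne : ¬ vanishingIdeal K A₂ ≤ vanishingIdeal K A₁)
    (hne' : ¬ vanishingIdeal K A₁ ≤ vanishingIdeal K A₂)
    (hd : idim (vanishingIdeal K (sumSet A₁ A₂)) ≤ d + 1) :
    ∃ W : Submodule K (σ → K), Module.finrank K W = d + 1 ∧ A₁ ⊆ W ∧ A₂ ⊆ W := by
  have h0₁ := hc₁.zero_mem (nonempty_of_isPrime h₁)
  have h0₂ := hc₂.zero_mem (nonempty_of_isPrime h₂)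
  let W := Submodule.span K (A₁ ∪ A₂)
  have hA₁ : A₁ ⊆ W := Set.subset_union_left.trans Submodule.subset_span
  have hA₂ : A₂ ⊆ W := Set.subset_union_right.trans Submodule.subset_span
  have htr : ∀ w ∈ W, ∀ c : K, ∀ f ∈ vanishingIdeal K (sumSet A₁ A₂),
      polyTranslate (c • w) f ∈ vanishingIdeal K (sumSet A₁ A₂) := by
    intro w hw
    induction hw using Submodule.span_induction with
    | mem w hw =>
      intro c f hf
      rcases hw with hw | hw
      · exact translate_mem_of_idim_le h₁ h₂ hc₁ hcl₂ h0₂ hne (by omega) (hc₁ c w hw) hf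
      · rw [sumSet_comm] at hf hd ⊢
        exact translate_mem_of_idim_le h₂ h₁ hc₂ hcl₁ h0₁ hne' (by omega) (hc₂ c w hw) hf
    | zero =>
      intro c f hf v hv
      rw [aeval_polyTranslate, smul_zero, add_zero]
      exact hf v hv
    | add x y _ _ hx hy =>
      intro c f hf v hv
      have := hy c _ (hx c f hf) v hv
      rw [aeval_polyTranslate, aeval_polyTranslate] at this
      rw [aeval_polyTranslate, ← this]
      congr 2
      rw [smul_add]
      abel
    | smul s x _ hx =>
      intro c f hf
      rw [smul_smul]
      exact hx _ f hf
  have hW := isPrime_vanishingIdeal_submodule W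
  have hsum := isPrime_sumSet h₁ h₂
  have hle : vanishingIdeal K (sumSet A₁ A₂) ≤ vanishingIdeal K (W : Set (σ → K)) := by
    intro f hf w hw
    have := htr w hw 1 f hf 0 ⟨0, h0₁, 0, h0₂, (add_zero 0).symm⟩
    rwa [aeval_polyTranslate, one_smul, zero_add] at this
  have hlt : vanishingIdeal K (W : Set (σ → K)) < vanishingIdeal K A₂ := by
    refine lt_of_le_of_ne (vanishingIdeal_anti_mono hA₂) fun h => hne ?_
    rw [← h]
    exact vanishingIdeal_anti_mono hA₁
  have e1 := idim_le hle
  have e2 := idim_lt hlt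
  rw [idim_vanishingIdeal_submodule] at e1 e2
  exact ⟨W, by omega, hA₁, hA₂⟩

theorem exists_common_subspace {K σ : Type} [Field K] [CharZero K] [Finite σ]
    {A₁ A₂ A : Set (σ → K)} {d : ℕ}
    (h₁ : (vanishingIdeal K A₁).IsPrime) (h₂ : (vanishingIdeal K A₂).IsPrime)
    (h : (vanishingIdeal K A).IsPrime)
    (hc₁ : IsCone A₁) (hc₂ : IsCone A₂) (hc : IsCone A)
    (hcl₁ : zeroLocus K (vanishingIdeal K A₁) = A₁) (hcl₂ : zeroLocus K (vanishingIdeal K A₂) = A₂)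
    (hd₁ : idim (vanishingIdeal K A₁) = d) (hd₂ : idim (vanishingIdeal K A₂) = d)
    (hd : idim (vanishingIdeal K A) = d)
    (hne : vanishingIdeal K A₁ ≠ vanishingIdeal K A₂)
    (hne₁ : vanishingIdeal K A ≠ vanishingIdeal K A₁)
    (hne₂ : vanishingIdeal K A ≠ vanishingIdeal K A₂)
    (hline : ∀ a ∈ A₁, ∀ b ∈ A₂, LinearIndependent K ![a, b] →
      ∃ s t : K, s • a + t • b ∈ A ∧ s • a + t • b ≠ 0) :
    ∃ W : Submodule K (σ → K), Module.finrank K W = d + 1 ∧ A₁ ⊆ W ∧ A₂ ⊆ W ∧ A ⊆ W := by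
  have hnle : ¬ vanishingIdeal K A₁ ≤ vanishingIdeal K A₂ := fun hle => hne
      (eq_of_idim_le hle (by omega))
  have hnle' : ¬ vanishingIdeal K A₂ ≤ vanishingIdeal K A₁ :=
    fun hle => hne (eq_of_idim_le hle (by omega)).symm
  have hnle₁ : ¬ vanishingIdeal K A ≤ vanishingIdeal K A₁ := fun hle => hne₁
      (eq_of_idim_le hle (by omega))
  have hnle₂ : ¬ vanishingIdeal K A ≤ vanishingIdeal K A₂ := fun hle => hne₂
      (eq_of_idim_le hle (by omega))
  have hA₁ := nonempty_of_isPrime h₁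
  have hA₂ := nonempty_of_isPrime h₂
  obtain ⟨L, _, _, p, q, μ, hpq, hy⟩ := exists_genericPair_with_third h₁ h₂ hc
      (nonempty_of_isPrime h)
    hc₂ hnle₂ hnle' hline
  have hμ : μ ≠ 0 := by
    rintro rfl
    refine hnle₁ fun f hf => ?_
    rw [← hpq.aeval_left hA₂]
    simpa using hy f hf
  have hple : vanishingIdeal K A ≤ RingHom.ker (aeval (R := K) (p + μ • q)) := hy
  have hpr : (RingHom.ker (aeval (R := K) (p + μ • q))).IsPrime := RingHom.ker_isPrime _
  have e1 := idim_le hple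
  have e2 := idim_ker_add_le hpq hA₁ hA₂ hμ
  rw [ker_aeval_add hpq] at e2
  have hsum := isPrime_sumSet h₁ h₂
  have h0₁ := hc₁.zero_mem hA₁
  have h0₂ := hc₂.zero_mem hA₂
  have hlt : vanishingIdeal K (sumSet A₁ A₂) < vanishingIdeal K A₂ := by
    refine lt_of_le_of_ne ?_ fun heq => hnle' ?_
    · exact vanishingIdeal_anti_mono fun b hb => ⟨0, h0₁, b, hb, (zero_add b).symm⟩
    · rw [← heq]
      exact vanishingIdeal_anti_mono fun a ha => ⟨a, ha, 0, h0₂, (add_zero a).symm⟩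
  have e3 := idim_lt hlt
  have hker := eq_of_idim_le hple (by omega)
  obtain ⟨W, hW, hW₁, hW₂⟩ :=
      exists_subspace_of_idim_sumSet_le h₁ h₂ hc₁ hc₂ hcl₁ hcl₂ hd₁ hd₂ hnle' hnle
    (by omega)
  refine ⟨W, hW, hW₁, hW₂, fun c hcA => ?_⟩
  by_contra hcW
  have := Fintype.ofFinite σ
  classical
  obtain ⟨ℓ, hℓ, hℓW⟩ := Submodule.exists_le_ker_of_notMem hcW
  have hℓ₀ : ∀ w ∈ W, ℓ w = 0 := fun w hw => hℓW hw
  have hp : aeval p (formPoly ℓ) = 0 := by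
    rw [hpq.aeval_left hA₂]
    exact fun a ha => by rw [aeval_formPoly, hℓ₀ a (hW₁ ha)]
  have hq : aeval q (formPoly ℓ) = 0 := by
    rw [hpq.aeval_right hA₁]
    exact fun a ha => by rw [aeval_formPoly, hℓ₀ a (hW₂ ha)]
  have hmem : formPoly ℓ ∈ vanishingIdeal K A := by
    rw [hker, RingHom.mem_ker, aeval_formPoly_add_smul, hp, hq, mul_zero, add_zero]
  have := hmem c hcA
  rw [aeval_formPoly] at this
  exact hℓ this

theorem exists_polynomial_line {K τ : Type} [Field K] (g : MvPolynomial τ K) (u v : τ → K) :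
    ∃ G : Polynomial K, ∀ s, G.eval s = aeval (u + s • v) g := by
  refine ⟨aeval (fun i => Polynomial.C (u i) + Polynomial.X * Polynomial.C (v i)) g, fun s => ?_⟩
  rw [← Polynomial.coe_aeval_eq_eval, comp_aeval_apply]
  congr 2
  funext i
  simp only [map_add, map_mul, Polynomial.aeval_C, Polynomial.aeval_X,
      Algebra.algebraMap_self_apply,
    Pi.add_apply, Pi.smul_apply, smul_eq_mul]

/-- A line through a point off a conical hypersurface meets the hypersurface. -/
theorem exists_aeval_add_smul_eq_zero {K τ : Type} [Field K] [IsAlgClosed K] {g : MvPolynomial τ K}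
    (hg : ∀ (c : K) (v : τ → K), aeval v g = 0 → aeval (c • v) g = 0)
    (hg0 : aeval (0 : τ → K) g = 0)
    {x : τ → K} (hx : aeval x g ≠ 0) (p : τ → K) :
    ∃ s : K, aeval (p + s • x) g = 0 := by
  by_contra! hcon
  have hconst : ∀ t : K, t ≠ 0 → aeval (x + t • p) g = aeval (0 + t • p) g := by
    intro t ht
    obtain ⟨G, hG⟩ := exists_polynomial_line g (t • p) x
    have hdeg : G.degree = 0 := by
      by_contra hdeg
      obtain ⟨s, hs⟩ := IsAlgClosed.exists_root G hdeg
      rw [Polynomial.IsRoot, hG] at hs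
      have := hg t⁻¹ _ hs
      rw [smul_add, smul_smul, smul_smul, inv_mul_cancel₀ ht, one_smul] at this
      exact hcon _ this
    rw [Polynomial.eq_C_of_degree_eq_zero hdeg] at hG
    have h0 := hG 0
    have h1 := hG 1
    rw [Polynomial.eval_C] at h0 h1
    rw [zero_smul, add_zero] at h0
    rw [one_smul, add_comm] at h1
    rw [← h1, h0, zero_add]
  obtain ⟨G₁, hG₁⟩ := exists_polynomial_line g x p
  obtain ⟨G₂, hG₂⟩ := exists_polynomial_line g 0 p
  have hz : Polynomial.X * (G₁ - G₂) = 0 := by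
    apply Polynomial.funext
    intro t
    rw [Polynomial.eval_mul, Polynomial.eval_X, Polynomial.eval_sub, Polynomial.eval_zero, hG₁, hG₂]
    by_cases ht : t = 0
    · rw [ht, zero_mul]
    · rw [hconst t ht, sub_self, mul_zero]
  have heq := sub_eq_zero.1 ((mul_eq_zero.1 hz).resolve_left Polynomial.X_ne_zero)
  have h1 := hG₁ 0
  rw [heq, hG₂, zero_smul, add_zero, add_zero, hg0] at h1
  exact hx h1.symm

theorem isPrime_of_comap {K R S : Type} [Field K] [CommRing R] [CommRing S] [Algebra K R]
    [Algebra K S]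
    {φ : R →ₐ[K] S} (hφ : Function.Surjective φ) {P : Ideal S} (h : (P.comap φ).IsPrime) :
    P.IsPrime := by
  refine ⟨fun hP => h.ne_top (by rw [hP, Ideal.comap_top]), fun {a b} hab => ?_⟩
  obtain ⟨a, rfl⟩ := hφ a
  obtain ⟨b, rfl⟩ := hφ b
  rw [← map_mul] at hab
  exact h.mem_or_mem (x := a) (y := b) hab

theorem exists_add_smul_mem {K σ : Type} [Field K] [IsAlgClosed K] [CharZero K] [Finite σ]
    {A : Set (σ → K)} {W : Submodule K (σ → K)} {d : ℕ} (hA : (vanishingIdeal K A).IsPrime)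
    (hc : IsCone A) (hcl : zeroLocus K (vanishingIdeal K A) = A)
    (hd : idim (vanishingIdeal K A) = d)
    (hW : Module.finrank K W = d + 1) (hAW : A ⊆ W) {x p : σ → K} (hx : x ∈ W) (hxA : x ∉ A)
    (hp : p ∈ W) : ∃ s : K, p + s • x ∈ A := by
  have := Fintype.ofFinite σ
  classical
  obtain ⟨M, hM, hMW⟩ := exists_parametrization W
  have hsurj := linSub_surjective hM
  set P := vanishingIdeal K (M ⁻¹' A) with hP
  have hcomap : P.comap (linSub M) = vanishingIdeal K A := by
    ext f
    constructor
    · intro h a ha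
      obtain ⟨v, rfl⟩ : a ∈ LinearMap.range M := hMW.ge (hAW ha)
      rw [← aeval_linSub]
      exact h v ha
    · intro h v hv
      rw [aeval_linSub]
      exact h _ hv
  have hPpr : P.IsPrime := by
    refine isPrime_of_comap hsurj ?_
    rwa [hcomap]
  have hPd : idim P = d := by
    rw [← idim_ker_of_surjective _ hsurj, hcomap, hd]
  have hbot : (⊥ : Ideal (MvPolynomial (Fin (Module.finrank K W)) K)).IsPrime := Ideal.isPrime_bot
  have hbotd : idim (⊥ : Ideal (MvPolynomial (Fin (Module.finrank K W)) K)) = d + 1 := by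
    rw [idim_bot, Nat.card_eq_fintype_card, Fintype.card_fin, hW]
  have hPne : P ≠ ⊥ := by
    rintro h
    rw [h, hbotd] at hPd
    omega
  obtain ⟨g, hgP, hg⟩ := hPpr.exists_mem_prime_of_ne_bot hPne
  have hgpr : (Ideal.span {g}).IsPrime := (Ideal.span_singleton_prime hg.ne_zero).2 hg
  have hlt : ⊥ < Ideal.span {g} := bot_lt_iff_ne_bot.2 (by simpa using hg.ne_zero)
  have hle : Ideal.span {g} ≤ P := (Ideal.span_singleton_le_iff_mem _).2 hgP
  have e := idim_lt hlt
  have heq := eq_of_idim_le hle (by omega)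
  have hzero : ∀ v, aeval v g = 0 ↔ M v ∈ A := by
    intro v
    constructor
    · intro h
      rw [← hcl]
      intro f hf
      rw [← hcomap, Ideal.mem_comap, ← heq, Ideal.mem_span_singleton] at hf
      obtain ⟨r, hr⟩ := hf
      rw [← aeval_linSub, hr, map_mul, h, zero_mul]
    · exact fun h => hgP v h
  obtain ⟨x, rfl⟩ : x ∈ LinearMap.range M := hMW.ge hx
  obtain ⟨p, rfl⟩ : p ∈ LinearMap.range M := hMW.ge hp
  obtain ⟨s, hs⟩ := exists_aeval_add_smul_eq_zero (g := g) (x := x)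
    (fun c v hv => by rw [hzero] at hv ⊢; rw [map_smul]; exact hc c _ hv)
    (by rw [hzero, map_zero]; exact hc.zero_mem (nonempty_of_isPrime hA))
    (fun h => hxA ((hzero x).1 h)) p
  refine ⟨s, ?_⟩
  rwa [hzero, map_add, map_smul] at hs

theorem idim_le_ringKrullDim {K σ : Type} [Field K] [Finite σ] (Q : Ideal (MvPolynomial σ K))
    [Q.IsPrime] : (idim Q : WithBot ℕ∞) ≤ ringKrullDim (MvPolynomial σ K ⧸ Q) := by
  obtain ⟨s, g, hg, hint⟩ := exists_integral_inj_algHom_of_fg K (MvPolynomial σ K ⧸ Q)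
  algebraize [g.toRingHom]
  have hT : IsScalarTower K (MvPolynomial (Fin s) K) (MvPolynomial σ K ⧸ Q) :=
    IsScalarTower.of_algebraMap_eq fun r => (g.commutes r).symm
  have hInt : Algebra.IsIntegral (MvPolynomial (Fin s) K) (MvPolynomial σ K ⧸ Q) := ⟨hint⟩
  have hF : FaithfulSMul (MvPolynomial (Fin s) K) (MvPolynomial σ K ⧸ Q) :=
    (faithfulSMul_iff_algebraMap_injective _ _).2 hg
  have hs : idim Q = s := by
    have h := trdeg_add_eq (R := K) (S := MvPolynomial (Fin s) K) (A := MvPolynomial σ K ⧸ Q)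
    rw [trdeg_eq_zero (R := MvPolynomial (Fin s) K), add_zero, MvPolynomial.trdeg_of_isDomain] at h
    rw [idim, ← h]
    simp
  have hdim : ((s : ℕ∞) : WithBot ℕ∞) ≤ ringKrullDim (MvPolynomial (Fin s) K) := by
    rw [MvPolynomial.ringKrullDim_of_isNoetherianRing, ringKrullDim_eq_zero_of_field]
    simp
  obtain ⟨l, hl⟩ := Order.le_krullDim_iff.1 hdim
  obtain ⟨P, -, hP, hPl⟩ := Ideal.exists_ideal_over_prime_of_isIntegral_of_isPrime
    (R := MvPolynomial (Fin s) K) (S := MvPolynomial σ K ⧸ Q) l.head.asIdeal ⊥ (by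
      rw [Ideal.comap_bot_of_injective (algebraMap _ _) hg]; exact bot_le)
  have : P.LiesOver l.head.asIdeal := ⟨hPl.symm⟩
  obtain ⟨m, hm, -⟩ := Ideal.exists_ltSeries_of_hasGoingUp l P
  rw [hs]
  exact Order.le_krullDim_iff.2 ⟨m, hm.trans hl⟩

/-- Scaling a point by an element of the field raises its dimension by at most one. -/
theorem idim_ker_le_idim_ker_add_one {K L σ : Type} [Field K] [Field L] [Algebra K L] [CharZero K]
    [Finite σ] (s : L) (z : σ → L) :
    idim (RingHom.ker (aeval (R := K) (s • z))) ≤ idim (RingHom.ker (aeval (R := K) z)) + 1 := by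
  rw [← finrank_derSpan, ← finrank_derSpan]
  have h : derSpan K (s • z) ≤ derSpan K z ⊔ Submodule.span L {z} := by
    rintro v ⟨D, hD⟩
    have : v = s • (fun i => D (z i)) + D s • z := by
      funext i
      rw [← hD]
      simp [mul_comm]
    rw [this]
    exact Submodule.add_mem_sup (Submodule.smul_mem _ _ ⟨D, fun i => rfl⟩)
      (Submodule.smul_mem _ _ (Submodule.mem_span_singleton_self z))
  have := Fintype.ofFinite σ
  calc _ ≤ _ := Submodule.finrank_mono h
    _ ≤ _ := Submodule.finrank_add_le_finrank_add_finrank _ _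
    _ ≤ _ := by gcongr; exact (finrank_span_le_card {z}).trans (by simp)

theorem aeval_smul_of_isHomogeneous {K L σ : Type} [Field K] [Field L] [Algebra K L]
    {f : MvPolynomial σ K} {d : ℕ} (hf : f.IsHomogeneous d) (c : L) (v : σ → L) : aeval (c • v) f =
        c ^ d * aeval v f := by
  rw [aeval_def, aeval_def, eval₂_eq, eval₂_eq, Finset.mul_sum]
  refine Finset.sum_congr rfl fun m hm => ?_
  have hd : ∑ i ∈ m.support, m i = d := by
    rw [← Finsupp.degree_apply, Finsupp.degree_eq_weight_one]
    exact hf (mem_support_iff.1 hm)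
  simp only [Pi.smul_apply, smul_eq_mul, mul_pow, Finset.prod_mul_distrib,
      Finset.prod_pow_eq_pow_sum,
    hd]
  ring

attribute [local instance] MvPolynomial.gradedAlgebra

theorem isHomogeneous_vanishingIdeal {K σ : Type} [Field K] [Infinite K] {A : Set (σ → K)}
    (hA : IsCone A) : (vanishingIdeal K A).IsHomogeneous (homogeneousSubmodule σ K) := by
  intro i f hf a ha
  have hdec := decomposition.decompose'_apply f i
  rw [DirectSum.Decomposition.decompose'_eq] at hdec
  rw [hdec]
  set G : Polynomial K := ∑ j ∈ Finset.range (f.totalDegree + 1),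
    Polynomial.monomial j (aeval a (homogeneousComponent j f))
  have hG : G = 0 := by
    refine Polynomial.funext fun c => ?_
    have := hf _ (hA c a ha)
    rw [← sum_homogeneousComponent f, map_sum] at this
    rw [Polynomial.eval_zero, ← this, Polynomial.eval_finsetSum]
    refine Finset.sum_congr rfl fun j _ => ?_
    rw [aeval_smul_of_isHomogeneous (homogeneousComponent_isHomogeneous j f),
        Polynomial.eval_monomial,
      mul_comm]
  by_cases hi : i < f.totalDegree + 1
  · have := congrArg (fun p => Polynomial.coeff p i) hG
    simpa [G, Polynomial.finsetSum_coeff, Polynomial.coeff_monomial, hi] using this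
  · rw [homogeneousComponent_eq_zero _ _ (by omega), map_zero]

/-- Homogenization with respect to the variable `X i`. -/
noncomputable def homogenize {K σ : Type} [Field K] (i : σ) (f : MvPolynomial σ K) :
    MvPolynomial σ K :=
  ∑ j ∈ Finset.range (f.totalDegree + 1), X i ^ (f.totalDegree - j) * homogeneousComponent j f

theorem homogenize_isHomogeneous {K σ : Type} [Field K] (i : σ) (f : MvPolynomial σ K) :
    (homogenize i f).IsHomogeneous f.totalDegree := by
  refine IsHomogeneous.sum _ _ _ fun j hj => ?_
  have := ((isHomogeneous_X K i).pow (f.totalDegree - j)).mul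
      (homogeneousComponent_isHomogeneous j f)
  rw [Finset.mem_range] at hj
  convert this using 1
  omega

theorem homogenize_sub_mem {K σ : Type} [Field K] {i : σ} {Q : Ideal (MvPolynomial σ K)}
    (hQ : X i - 1 ∈ Q) (f : MvPolynomial σ K) : homogenize i f - f ∈ Q := by
  have h : homogenize i f - f = ∑ j ∈ Finset.range (f.totalDegree + 1),
      (X i ^ (f.totalDegree - j) * homogeneousComponent j f - homogeneousComponent j f) := by
    rw [Finset.sum_sub_distrib, sum_homogeneousComponent, homogenize]
  rw [h]
  refine Ideal.sum_mem _ fun j _ => ?_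
  rw [← sub_one_mul]
  refine Ideal.mul_mem_right _ _ ?_
  obtain ⟨r, hr⟩ := sub_one_dvd_pow_sub_one (X i : MvPolynomial σ K) (f.totalDegree - j)
  rw [hr]
  exact Ideal.mul_mem_right _ _ hQ

variable {K : Type} [Field K] {n : ℕ}

/-- The affine cone over a set of points of projective space. -/
def affineCone (Y : Set (Pn K n)) : Set (Fin (n + 1) → K) :=
  {v | ∃ x ∈ Y, ∃ c : K, v = c • x.rep}

theorem isCone_affineCone (Y : Set (Pn K n)) : IsCone (affineCone Y) := by
  rintro c _ ⟨x, hx, d, rfl⟩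
  exact ⟨x, hx, c * d, (mul_smul c d _).symm⟩

theorem mem_affineCone_iff {Y : Set (Pn K n)} {v : Fin (n + 1) → K} (hv : v ≠ 0) :
    v ∈ affineCone Y ↔ Projectivization.mk K v hv ∈ Y := by
  constructor
  · rintro ⟨x, hx, c, rfl⟩
    have : Projectivization.mk K (c • x.rep) hv = x := by
      conv_rhs => rw [← x.mk_rep]
      exact (Projectivization.mk_eq_mk_iff' K _ _ _ _).2 ⟨c, rfl⟩
    rwa [this]
  · intro h
    obtain ⟨c, hc⟩ := (Projectivization.mk_eq_mk_iff' K v _ hv (Projectivization.rep_nonzero _)).1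
      (Projectivization.mk_rep (Projectivization.mk K v hv)).symm
    exact ⟨_, h, c, hc.symm⟩

theorem rep_mem_affineCone {Y : Set (Pn K n)} {x : Pn K n} : x.rep ∈ affineCone Y ↔ x ∈ Y := by
  rw [mem_affineCone_iff x.rep_nonzero, x.mk_rep]

theorem affineCone_subset_iff {Y : Set (Pn K n)} {W : Submodule K (Fin (n + 1) → K)} :
    affineCone Y ⊆ W ↔ Y ⊆ projLinear K W := by
  constructor
  · intro h x hx
    exact h (rep_mem_affineCone.2 hx)
  · rintro h _ ⟨x, hx, c, rfl⟩
    exact W.smul_mem c (h hx)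

theorem affineCone_injective : Function.Injective (affineCone : Set (Pn K n) → _) := by
  intro Y Z h
  ext x
  rw [← rep_mem_affineCone, h, rep_mem_affineCone]

theorem affineCone_mono {Y Z : Set (Pn K n)} (h : Y ⊆ Z) : affineCone Y ⊆ affineCone Z := by
  rintro _ ⟨x, hx, c, rfl⟩
  exact ⟨x, h hx, c, rfl⟩

theorem isOpen_setOf_aeval_ne_zero {f : MvPolynomial (Fin (n + 1)) K} {d : ℕ}
    (hf : f.IsHomogeneous d) :
    IsOpen {x : Pn K n | aeval x.rep f ≠ 0} :=
  TopologicalSpace.isOpen_generateFrom_of_mem ⟨f, d, hf, rfl⟩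

theorem exists_homogeneous_of_isOpen {U : Set (Pn K n)} (hU : IsOpen U) {x : Pn K n} (hx : x ∈ U) :
    ∃ (f : MvPolynomial (Fin (n + 1)) K) (d : ℕ), f.IsHomogeneous d ∧ aeval x.rep f ≠ 0 ∧
      ∀ y : Pn K n, aeval y.rep f ≠ 0 → y ∈ U := by
  induction hU with
  | basic s hs =>
    obtain ⟨f, d, hf, rfl⟩ := hs
    exact ⟨f, d, hf, hx, fun y hy => hy⟩
  | univ => exact ⟨1, 0, isHomogeneous_one _ _, by simp, fun _ _ => trivial⟩
  | inter s t _ _ ihs iht =>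
    obtain ⟨f, d, hf, hfx, hfs⟩ := ihs hx.1
    obtain ⟨g, e, hg, hgx, hgt⟩ := iht hx.2
    refine ⟨f * g, d + e, hf.mul hg, by rw [map_mul]; exact mul_ne_zero hfx hgx, fun y hy => ?_⟩
    rw [map_mul] at hy
    exact ⟨hfs y (left_ne_zero_of_mul hy), hgt y (right_ne_zero_of_mul hy)⟩
  | sUnion S _ ih =>
    obtain ⟨s, hs, hxs⟩ := hx
    obtain ⟨f, d, hf, hfx, hfs⟩ := ih s hs hxs
    exact ⟨f, d, hf, hfx, fun y hy => ⟨s, hs, hfs y hy⟩⟩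

theorem mem_vanishingIdeal_affineCone_iff {Y : Set (Pn K n)} {f : MvPolynomial (Fin (n + 1)) K}
    {d : ℕ}
    (hf : f.IsHomogeneous d) :
    f ∈ vanishingIdeal K (affineCone Y) ↔ ∀ x ∈ Y, aeval x.rep f = 0 := by
  constructor
  · intro h x hx
    exact h _ (rep_mem_affineCone.2 hx)
  · rintro h _ ⟨x, hx, c, rfl⟩
    rw [aeval_smul_of_isHomogeneous hf, h x hx, mul_zero]

theorem zeroLocus_vanishingIdeal_affineCone {Y : Set (Pn K n)} (hY : IsClosed Y)
    (hne : Y.Nonempty) :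
    zeroLocus K (vanishingIdeal K (affineCone Y)) = affineCone Y := by
  refine subset_antisymm (fun v hv => ?_) (zeroLocus_vanishingIdeal_le _)
  by_cases hv0 : v = 0
  · obtain ⟨x, hx⟩ := hne
    exact ⟨x, hx, 0, by simp [hv0]⟩
  rw [mem_affineCone_iff hv0]
  by_contra hx
  obtain ⟨f, d, hf, hfx, hfU⟩ := exists_homogeneous_of_isOpen hY.isOpen_compl hx
  have hfY : f ∈ vanishingIdeal K (affineCone Y) := by
    rw [mem_vanishingIdeal_affineCone_iff hf]
    intro y hy
    by_contra h
    exact hfU y h hy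
  obtain ⟨c, hc⟩ := (Projectivization.mk_eq_mk_iff' K _ v (Projectivization.rep_nonzero _) hv0).1
    (Projectivization.mk_rep (Projectivization.mk K v hv0))
  apply hfx
  rw [← hc, aeval_smul_of_isHomogeneous hf, hv f hfY, mul_zero]

theorem isPrime_vanishingIdeal_affineCone [Infinite K] {Y : Set (Pn K n)} (hY : IsIrreducible Y) :
    (vanishingIdeal K (affineCone Y)).IsPrime := by
  refine (isHomogeneous_vanishingIdeal
      (isCone_affineCone Y)).isPrime_of_homogeneous_mem_or_mem ?_ ?_
  · obtain ⟨x, hx⟩ := hY.nonempty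
    rw [Ne, Ideal.eq_top_iff_one]
    intro h
    simpa using h _ (rep_mem_affineCone.2 hx)
  · rintro f g ⟨d, hf⟩ ⟨e, hg⟩ hfg
    rw [mem_homogeneousSubmodule] at hf hg
    rw [mem_vanishingIdeal_affineCone_iff hf, mem_vanishingIdeal_affineCone_iff hg]
    by_contra! h
    obtain ⟨⟨x, hx, hfx⟩, y, hy, hgy⟩ := h
    obtain ⟨z, hz, hzf, hzg⟩ := hY.isPreirreducible _ _ (isOpen_setOf_aeval_ne_zero hf)
      (isOpen_setOf_aeval_ne_zero hg) ⟨x, hx, hfx⟩ ⟨y, hy, hgy⟩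
    have := hfg _ (rep_mem_affineCone.2 hz)
    rw [map_mul] at this
    exact mul_ne_zero hzf hzg this

/-- The projective zero locus of an ideal. -/
def projZeros (P : Ideal (MvPolynomial (Fin (n + 1)) K)) : Set (Pn K n) :=
  {x | x.rep ∈ zeroLocus K P}

theorem isClosed_projZeros {P : Ideal (MvPolynomial (Fin (n + 1)) K)}
    (hP : P.IsHomogeneous (homogeneousSubmodule _ K)) : IsClosed (projZeros P) := by
  have : projZeros P = ⋂ f : P, ⋂ j : ℕ,
      {x : Pn K n | aeval x.rep (homogeneousComponent j f.1) ≠ 0}ᶜ := by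
    ext x
    simp only [Set.mem_iInter, Set.mem_compl_iff, Set.mem_ofPred_eq, not_not]
    constructor
    · intro h f j
      exact h _ (homogeneousComponent_mem_of_mem hP f.2 j)
    · intro h f hf
      rw [← sum_homogeneousComponent f, map_sum]
      exact Finset.sum_eq_zero fun j _ => h ⟨f, hf⟩ j
  rw [this]
  exact isClosed_iInter fun f => isClosed_iInter fun j =>
    (isOpen_setOf_aeval_ne_zero (homogeneousComponent_isHomogeneous j f.1)).isClosed_compl

theorem smul_mem_zeroLocus {σ : Type} {P : Ideal (MvPolynomial σ K)}
    (hP : P.IsHomogeneous (homogeneousSubmodule _ K)) : IsCone (zeroLocus K P) := by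
  intro c v hv f hf
  rw [← sum_homogeneousComponent f, map_sum]
  refine Finset.sum_eq_zero fun j _ => ?_
  rw [aeval_smul_of_isHomogeneous (homogeneousComponent_isHomogeneous j f),
    hv _ (homogeneousComponent_mem_of_mem hP hf j), mul_zero]

theorem mk_mem_projZeros {P : Ideal (MvPolynomial (Fin (n + 1)) K)}
    (hP : P.IsHomogeneous (homogeneousSubmodule _ K)) {v : Fin (n + 1) → K} (hv : v ≠ 0)
    (h : v ∈ zeroLocus K P) : Projectivization.mk K v hv ∈ projZeros P := by
  obtain ⟨c, hc⟩ := (Projectivization.mk_eq_mk_iff' K _ v (Projectivization.rep_nonzero _) hv).1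
    (Projectivization.mk_rep (Projectivization.mk K v hv))
  rw [projZeros, Set.mem_ofPred_eq, ← hc]
  exact smul_mem_zeroLocus hP c v h

theorem exists_mem_projZeros [IsAlgClosed K] {P : Ideal (MvPolynomial (Fin (n + 1)) K)}
    [hp : P.IsPrime]
    (hP : P.IsHomogeneous (homogeneousSubmodule _ K)) {i : Fin (n + 1)} (hi : X i ∉ P)
    {f : MvPolynomial (Fin (n + 1)) K} {d : ℕ} (hfd : f.IsHomogeneous d) (hf : f ∉ P) :
    ∃ x ∈ projZeros P, aeval x.rep f ≠ 0 := by
  have h : f * X i ∉ P := fun h => (hp.mem_or_mem h).elim hf hi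
  rw [← MvPolynomial.IsPrime.vanishingIdeal_zeroLocus (K := K) P, mem_vanishingIdeal_iff] at h
  push Not at h
  obtain ⟨v, hv, hfv⟩ := h
  rw [map_mul, aeval_X] at hfv
  have hv0 : v ≠ 0 := by
    rintro rfl
    simp at hfv
  refine ⟨_, mk_mem_projZeros hP hv0 hv, fun h => ?_⟩
  obtain ⟨c, hc⟩ := (Projectivization.mk_eq_mk_iff' K v _ hv0 (Projectivization.rep_nonzero _)).1
    (Projectivization.mk_rep (Projectivization.mk K v hv0)).symm
  apply left_ne_zero_of_mul hfv
  rw [← hc, aeval_smul_of_isHomogeneous hfd, h, mul_zero]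

theorem isIrreducible_projZeros [IsAlgClosed K] {P : Ideal (MvPolynomial (Fin (n + 1)) K)}
    [hp : P.IsPrime]
    (hP : P.IsHomogeneous (homogeneousSubmodule _ K)) {i : Fin (n + 1)} (hi : X i ∉ P) :
    IsIrreducible (projZeros P) := by
  refine ⟨?_, ?_⟩
  · obtain ⟨x, hx, -⟩ := exists_mem_projZeros hP hi (isHomogeneous_X K i) hi
    exact ⟨x, hx⟩
  · rintro U V hU hV ⟨x, hx, hxU⟩ ⟨y, hy, hyV⟩
    obtain ⟨f, d, hf, hfx, hfU⟩ := exists_homogeneous_of_isOpen hU hxU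
    obtain ⟨g, e, hg, hgy, hgV⟩ := exists_homogeneous_of_isOpen hV hyV
    obtain ⟨z, hz, hfgz⟩ := exists_mem_projZeros hP hi (hf.mul hg)
      (fun h => (hp.mem_or_mem h).elim (fun h => hfx (hx f h)) (fun h => hgy (hy g h)))
    rw [map_mul] at hfgz
    exact ⟨z, hz, hfU z (left_ne_zero_of_mul hfgz), hgV z (right_ne_zero_of_mul hfgz)⟩

theorem le_of_projZeros_subset [IsAlgClosed K] {P Q : Ideal (MvPolynomial (Fin (n + 1)) K)}
    [P.IsPrime]
    (hP : P.IsHomogeneous (homogeneousSubmodule _ K))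
    (hQ : Q.IsHomogeneous (homogeneousSubmodule _ K))
    {i : Fin (n + 1)} (hi : X i ∉ P) (h : projZeros P ⊆ projZeros Q) : Q ≤ P := by
  intro f hf
  rw [mem_iff_homogeneousComponent_mem hP]
  intro j
  by_contra hj
  obtain ⟨x, hx, hfx⟩ := exists_mem_projZeros hP hi (homogeneousComponent_isHomogeneous j f) hj
  exact hfx (h hx _ (homogeneousComponent_mem_of_mem hQ hf j))

theorem one_le_idim_vanishingIdeal_affineCone [Infinite K] {Y : Set (Pn K n)}
    (hY : IsIrreducible Y) :
    1 ≤ idim (vanishingIdeal K (affineCone Y)) := by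
  obtain ⟨x, hx⟩ := hY.nonempty
  have := isPrime_vanishingIdeal_affineCone hY
  have := isPrime_vanishingIdeal_submodule (Submodule.span K {x.rep})
  refine (finrank_span_singleton (K := K) x.rep_nonzero).ge.trans ?_
  rw [← idim_vanishingIdeal_submodule]
  refine idim_le (vanishingIdeal_anti_mono fun v hv => ?_)
  obtain ⟨c, rfl⟩ := Submodule.mem_span_singleton.1 hv
  exact ⟨x, hx, c, rfl⟩

theorem sdim_add_one_le_idim [Infinite K] {Y : Set (Pn K n)} (hY : IsClosed Y)
    (hirr : IsIrreducible Y) {k : ℕ} (hk : (k : WithBot ℕ∞) ≤ sdim Y) :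
    k + 1 ≤ idim (vanishingIdeal K (affineCone Y)) := by
  obtain ⟨l, hl⟩ := Order.le_krullDim_iff.1 hk
  have himg : ∀ C : TopologicalSpace.IrreducibleCloseds Y,
      IsIrreducible (Subtype.val '' (C : Set Y)) ∧ IsClosed (Subtype.val '' (C : Set Y)) := fun C =>
    ⟨C.isIrreducible.image _ continuous_subtype_val.continuousOn,
      hY.isClosedEmbedding_subtypeVal.isClosedMap _ C.isClosed⟩
  let φ : TopologicalSpace.IrreducibleCloseds Y → ℕ := fun C =>
    idim (vanishingIdeal K (affineCone (Subtype.val '' (C : Set Y))))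
  have hφ : StrictMono φ := by
    intro C D hCD
    have := isPrime_vanishingIdeal_affineCone (himg C).1
    have := isPrime_vanishingIdeal_affineCone (himg D).1
    refine idim_lt (lt_of_le_of_ne (vanishingIdeal_anti_mono (affineCone_mono
      (Set.image_mono hCD.le))) fun h => hCD.ne ?_)
    have h2 := congrArg (zeroLocus K) h
    rw [zeroLocus_vanishingIdeal_affineCone (himg C).2 (himg C).1.nonempty,
      zeroLocus_vanishingIdeal_affineCone (himg D).2 (himg D).1.nonempty] at h2
    exact TopologicalSpace.IrreducibleCloseds.ext
      (Set.image_injective.2 Subtype.val_injective (affineCone_injective h2).symm)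
  have h1 := (l.map φ hφ).head_add_length_le_nat
  have h2 : 1 ≤ (l.map φ hφ).head := by
    rw [LTSeries.head_map]
    exact one_le_idim_vanishingIdeal_affineCone (himg _).1
  have h3 : (l.map φ hφ).last ≤ idim (vanishingIdeal K (affineCone Y)) := by
    rw [LTSeries.last_map]
    have := isPrime_vanishingIdeal_affineCone (himg l.last).1
    have := isPrime_vanishingIdeal_affineCone hirr
    exact idim_le (vanishingIdeal_anti_mono (affineCone_mono (by simp)))
  have h4 : (l.map φ hφ).length = k := hl
  omega

theorem isIrreducible_preimage_val {α : Type*} [TopologicalSpace α] {Y Z : Set α}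
    (hZ : IsIrreducible Z) (h : Z ⊆ Y) : IsIrreducible ((Subtype.val : Y → α) ⁻¹' Z) := by
  obtain ⟨z, hz⟩ := hZ.nonempty
  refine ⟨⟨⟨z, h hz⟩, hz⟩, ?_⟩
  rintro _ _ ⟨U, hU, rfl⟩ ⟨V, hV, rfl⟩ ⟨x, hx, hxU⟩ ⟨y, hy, hyV⟩
  obtain ⟨w, hw, hwU, hwV⟩ := hZ.isPreirreducible U V hU hV ⟨x, hx, hxU⟩ ⟨y, hy, hyV⟩
  exact ⟨⟨w, h hw⟩, hw, hwU, hwV⟩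

theorem ringKrullDim_le_sdim [IsAlgClosed K] {Y : Set (Pn K n)} (hY : IsClosed Y)
    (hirr : IsIrreducible Y) {Q : Ideal (MvPolynomial (Fin (n + 1)) K)} [Q.IsPrime]
    {i : Fin (n + 1)}
    (hi : X i - 1 ∈ Q) (hQ : vanishingIdeal K (affineCone Y) ≤ Q) :
    ringKrullDim (MvPolynomial (Fin (n + 1)) K ⧸ Q) ≤ sdim Y := by
  let R := MvPolynomial (Fin (n + 1)) K
  let c : PrimeSpectrum (R ⧸ Q) → Ideal R := fun p => p.asIdeal.comap (Ideal.Quotient.mk Q)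
  have hcQ : ∀ p, Q ≤ c p := fun p f hf => by
    change Ideal.Quotient.mk Q f ∈ p.asIdeal
    rw [Ideal.Quotient.eq_zero_iff_mem.2 hf]
    exact p.asIdeal.zero_mem
  have hcprime : ∀ p, (c p).IsPrime := fun p => Ideal.IsPrime.comap _
  let e : PrimeSpectrum (R ⧸ Q) → Ideal R := fun p =>
    ((c p).homogeneousCore (homogeneousSubmodule (Fin (n + 1)) K)).toIdeal
  have he : ∀ p, (e p).IsHomogeneous (homogeneousSubmodule (Fin (n + 1)) K) := fun p =>
    HomogeneousIdeal.isHomogeneous _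
  have heprime : ∀ p, (e p).IsPrime := fun p => (hcprime p).homogeneousCore
  have hec : ∀ p, e p ≤ c p := fun p => Ideal.toIdeal_homogeneousCore_le _ _
  have hei : ∀ p, X i ∉ e p := fun p h => (hcprime p).ne_top (by
    rw [Ideal.eq_top_iff_one]
    have := (c p).sub_mem (hec p h) (hcQ p hi)
    rwa [sub_sub_cancel] at this)
  have hhom : ∀ p f, f ∈ c p ↔ homogenize i f ∈ e p := by
    intro p f
    have h := homogenize_sub_mem (hcQ p hi) f
    constructor
    · intro hf
      refine Ideal.mem_homogeneousCore_of_homogeneous_of_mem ⟨_, homogenize_isHomogeneous i f⟩ ?_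
      simpa using (c p).add_mem h hf
    · intro hf
      simpa using (c p).sub_mem (hec p hf) h
  have hYe : ∀ p, vanishingIdeal K (affineCone Y) ≤ e p := fun p => by
    rw [← (isHomogeneous_vanishingIdeal
      (isCone_affineCone Y)).toIdeal_homogeneousCore_eq_self]
    exact Ideal.homogeneousCore_mono _ (hQ.trans (hcQ p))
  have hsub : ∀ p, projZeros (e p) ⊆ Y := fun p x hx => by
    rw [← rep_mem_affineCone, ← zeroLocus_vanishingIdeal_affineCone hY hirr.nonempty]
    exact fun f hf => hx f (hYe p hf)
  let F : (PrimeSpectrum (R ⧸ Q))ᵒᵈ → TopologicalSpace.IrreducibleCloseds Y := fun p =>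
    ⟨Subtype.val ⁻¹' projZeros (e (OrderDual.ofDual p)),
      isIrreducible_preimage_val (isIrreducible_projZeros (he _) (hei _)) (hsub _),
      (isClosed_projZeros (he _)).preimage continuous_subtype_val⟩
  have hF : StrictMono F := by
    intro p q hpq
    have hle : e (OrderDual.ofDual q) ≤ e (OrderDual.ofDual p) :=
      Ideal.homogeneousCore_mono _ (Ideal.comap_mono hpq.le)
    refine lt_of_le_of_ne (fun x hx f hf => hx f (hle hf)) fun h => hpq.ne' ?_
    have hsub' : projZeros (e (OrderDual.ofDual q)) ⊆ projZeros (e (OrderDual.ofDual p)) := by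
      intro x hx
      have : (⟨x, hsub _ hx⟩ : Y) ∈ F q := hx
      rw [← h] at this
      exact this
    have hle' := le_of_projZeros_subset (he _) (he _) (hei _) hsub'
    apply OrderDual.ofDual.injective
    refine PrimeSpectrum.ext (Ideal.comap_injective_of_surjective _ Ideal.Quotient.mk_surjective ?_)
    refine le_antisymm (Ideal.comap_mono hpq.le) fun f hf => ?_
    exact (hhom (OrderDual.ofDual q) f).2 (hle' ((hhom (OrderDual.ofDual p) f).1 hf))
  have := Order.krullDim_le_of_strictMono F hF
  rwa [Order.krullDim_orderDual] at this

theorem idim_vanishingIdeal_affineCone [IsAlgClosed K] [CharZero K] {Y : Set (Pn K n)}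
    (hY : IsClosed Y) (hirr : IsIrreducible Y) {k : ℕ} (hk : sdim Y = (k : WithBot ℕ∞)) :
    idim (vanishingIdeal K (affineCone Y)) = k + 1 := by
  refine le_antisymm ?_ (sdim_add_one_le_idim hY hirr hk.ge)
  obtain ⟨y, hy⟩ := hirr.nonempty
  obtain ⟨i, hi⟩ := Function.ne_iff.1 y.rep_nonzero
  have hXi : X i ∉ vanishingIdeal K (affineCone Y) := fun h =>
    hi (by simpa using h _ (rep_mem_affineCone.2 hy))
  obtain ⟨L, _, _, φ, hφ⟩ := exists_field_of_isPrime (K := K) _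
      (isPrime_vanishingIdeal_affineCone hirr)
  set x : Fin (n + 1) → L := fun j => φ (X j) with hx
  have hφx : φ = aeval x := by
    ext j
    simp [hx]
  have hxi : x i ≠ 0 := fun h => hXi ((hφ _).1 h)
  set z : Fin (n + 1) → L := (x i)⁻¹ • x with hz
  have hxz : x = x i • z := by rw [hz, smul_smul, mul_inv_cancel₀ hxi, one_smul]
  have hker : vanishingIdeal K (affineCone Y) = RingHom.ker (aeval (R := K) (x i • z)) := by
    ext f
    rw [← hxz, RingHom.mem_ker, ← hφx, hφ]
  have hQ : (RingHom.ker (aeval (R := K) z)).IsPrime := RingHom.ker_isPrime _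
  have hd := idim_ker_le_idim_ker_add_one (K := K) (x i) z
  rw [← hker] at hd
  refine hd.trans (Nat.add_le_add_right ?_ 1)
  have h1 := (idim_le_ringKrullDim (RingHom.ker (aeval (R := K) z))).trans
    (ringKrullDim_le_sdim hY hirr (i := i) ?_ ?_)
  · rw [hk] at h1
    exact_mod_cast h1
  · rw [RingHom.mem_ker]
    simp [hz, hxi]
  · intro f hf
    rw [mem_iff_homogeneousComponent_mem (isHomogeneous_vanishingIdeal (isCone_affineCone Y))] at hf
    rw [← sum_homogeneousComponent f]
    refine Ideal.sum_mem _ fun j _ => ?_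
    have h2 := hf j
    rw [← hφ, hφx] at h2
    rw [RingHom.mem_ker, hz, aeval_smul_of_isHomogeneous (homogeneousComponent_isHomogeneous j f),
        h2,
      mul_zero]

theorem range_pair {V : Type} (a b : V) : Set.range ![a, b] = {a, b} := by
  simp [Matrix.range_cons, Set.pair_comm]

theorem linearIndependent_rep_of_ne {p q : Pn K n} (h : p ≠ q) :
    LinearIndependent K ![p.rep, q.rep] := by
  rw [LinearIndependent.pair_iff' p.rep_nonzero]
  intro c hc
  apply h
  rw [← p.mk_rep, ← q.mk_rep, eq_comm]
  exact (Projectivization.mk_eq_mk_iff' K _ _ _ _).2 ⟨c, hc⟩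

theorem lineOf_mem_joinLines {Y₁ Y₂ : Set (Pn K n)} {a b : Fin (n + 1) → K} (ha : a ∈ affineCone Y₁)
    (hb : b ∈ affineCone Y₂) (h : LinearIndependent K ![a, b]) :
    lineOf K ⟨![a, b], h⟩ ∈ joinLines K Y₁ Y₂ := by
  have ha0 : a ≠ 0 := h.ne_zero 0
  have hb0 : b ≠ 0 := h.ne_zero 1
  have key : ∀ v : Fin (n + 1) → K, ∀ hv : v ≠ 0, v ∈ Set.range ![a, b] →
      Projectivization.mk K v hv ∈ (lineOf K ⟨![a, b], h⟩).1 := by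
    intro v hv hmem
    obtain ⟨c, hc⟩ := (Projectivization.mk_eq_mk_iff' K _ v (Projectivization.rep_nonzero _) hv).1
      (Projectivization.mk_rep (Projectivization.mk K v hv))
    change (Projectivization.mk K v hv).rep ∈ Submodule.span K (Set.range ![a, b])
    rw [← hc]
    exact Submodule.smul_mem _ _ (Submodule.subset_span hmem)
  refine ⟨_, (mem_affineCone_iff ha0).1 ha, _, (mem_affineCone_iff hb0).1 hb, fun hab => ?_,
    key a ha0 ⟨0, rfl⟩, key b hb0 ⟨1, rfl⟩⟩
  obtain ⟨c, hc⟩ := (Projectivization.mk_eq_mk_iff' K _ _ _ _).1 hab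
  rw [LinearIndependent.pair_iff] at h
  have := (h 1 (-c) (by rw [← hc]; simp)).1
  exact one_ne_zero this

theorem exists_combination_mem {Y₁ Y₂ Y : Set (Pn K n)}
    (hSY : joiningComponent K Y₁ Y₂ ⊆ Delta K Y) {a b : Fin (n + 1) → K} (ha : a ∈ affineCone Y₁)
    (hb : b ∈ affineCone Y₂) (h : LinearIndependent K ![a, b]) :
    ∃ s t : K, s • a + t • b ∈ affineCone Y ∧ s • a + t • b ≠ 0 := by
  obtain ⟨x, hxl, hx⟩ := hSY (subset_closure (lineOf_mem_joinLines ha hb h))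
  have hxl' : x.rep ∈ Submodule.span K (Set.range ![a, b]) := hxl
  rw [range_pair, Submodule.mem_span_pair] at hxl'
  obtain ⟨s, t, hst⟩ := hxl'
  exact ⟨s, t, by rw [hst]; exact rep_mem_affineCone.2 hx, by rw [hst]; exact x.rep_nonzero⟩

theorem isClosed_setOf_apply_mem (W : Submodule K (Fin (n + 1) → K)) (j : Fin 2) :
    @IsClosed _ (affZariski2 K n) {v : Fin 2 → Fin (n + 1) → K | v j ∈ W} := by
  let _ := affZariski2 K n
  have : {v : Fin 2 → Fin (n + 1) → K | v j ∈ W}ᶜ =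
      ⋃ f : {f : Module.Dual K (Fin (n + 1) → K) // W ≤ LinearMap.ker f}, {v | f.1 (v j) ≠ 0} := by
    ext v
    simp only [Set.mem_compl_iff, Set.mem_ofPred_eq, Set.mem_iUnion]
    constructor
    · intro hv
      obtain ⟨f, hf, hW⟩ := Submodule.exists_le_ker_of_notMem hv
      exact ⟨⟨f, hW⟩, hf⟩
    · rintro ⟨f, hf⟩ hv
      exact hf (f.2 hv)
  rw [← isOpen_compl_iff, this]
  refine isOpen_iUnion fun f => TopologicalSpace.isOpen_generateFrom_of_mem
    ⟨∑ i, C (f.1 (Pi.single i 1)) * X (j, i), ?_⟩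
  ext v
  simp only [Set.mem_ofPred_eq]
  rw [LinearMap.pi_apply_eq_sum_univ f.1 (v j)]
  have hsingle : ∀ i : Fin (n + 1), (fun j => if i = j then (1 : K) else 0) = Pi.single i 1 := by
    intro i
    ext j
    simp [Pi.single_apply, eq_comm]
  simp [map_sum, mul_comm, hsingle]

theorem isClosed_setOf_subset_projLinear (W : Submodule K (Fin (n + 1) → K)) :
    IsClosed {l : Grass K n | l.1 ⊆ projLinear K W} := by
  have h : IsClosed ((lineOf K (n := n)) ⁻¹' {l : Grass K n | l.1 ⊆ projLinear K W}) := by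
    have h2 : (lineOf K (n := n)) ⁻¹' {l : Grass K n | l.1 ⊆ projLinear K W} =
        Subtype.val ⁻¹' ({v : Fin 2 → Fin (n + 1) → K | v 0 ∈ W} ∩ {v | v 1 ∈ W}) := by
      ext v
      have hv : Set.range v.1 = {v.1 0, v.1 1} := by
        rw [← range_pair]; congr 1; ext i : 1; fin_cases i <;> rfl
      constructor
      · intro hl
        have key : ∀ i, v.1 i ∈ W := by
          intro i
          rw [SetLike.mem_coe.symm]
          have hi := v.2.ne_zero i
          obtain ⟨c, hc⟩ := (Projectivization.mk_eq_mk_iff' K (v.1 i) _ hi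
            (Projectivization.rep_nonzero _)).1
                (Projectivization.mk_rep (Projectivization.mk K _ hi)).symm
          obtain ⟨d, hd⟩ := (Projectivization.mk_eq_mk_iff' K _ (v.1 i)
            (Projectivization.rep_nonzero _) hi).1
                (Projectivization.mk_rep (Projectivization.mk K _ hi))
          have hmem : Projectivization.mk K _ hi ∈ (lineOf K v).1 := by
            change (Projectivization.mk K _ hi).rep ∈ Submodule.span K (Set.range v.1)
            rw [← hd]
            exact Submodule.smul_mem _ _ (Submodule.subset_span ⟨i, rfl⟩)
          rw [← hc]
          exact W.smul_mem c (hl hmem)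
        exact ⟨key 0, key 1⟩
      · rintro ⟨h0, h1⟩ x hx
        have hx' : x.rep ∈ Submodule.span K (Set.range v.1) := hx
        rw [hv] at hx'
        refine Submodule.span_le.2 ?_ hx'
        rintro _ (rfl | rfl)
        · exact h0
        · exact h1
    rw [h2]
    let _ := affZariski2 K n
    exact ((isClosed_setOf_apply_mem W 0).inter (isClosed_setOf_apply_mem W 1)).preimage
      continuous_subtype_val
  exact isClosed_coinduced.2 h

theorem linesUnion_joiningComponent_subset {W : Submodule K (Fin (n + 1) → K)}
    {Y₁ Y₂ : Set (Pn K n)}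
    (h₁ : Y₁ ⊆ projLinear K W) (h₂ : Y₂ ⊆ projLinear K W) :
    linesUnion K (joiningComponent K Y₁ Y₂) ⊆ projLinear K W := by
  refine Set.iUnion₂_subset fun l hl => ?_
  refine closure_minimal ?_ (isClosed_setOf_subset_projLinear W) hl
  rintro ⟨_, U, hU, rfl⟩ ⟨p, hp, q, hq, hpq, hpl, hql⟩ x hx
  have hpU : p.rep ∈ U := hpl
  have hqU : q.rep ∈ U := hql
  have hind := linearIndependent_rep_of_ne hpq
  have hspan : Submodule.span K {p.rep, q.rep} = U := by
    have := FiniteDimensional.finiteDimensional_submodule U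
    refine Submodule.eq_of_le_of_finrank_eq ?_ ?_
    · rw [Submodule.span_le]
      rintro _ (rfl | rfl)
      · exact hpU
      · exact hqU
    · rw [hU, ← range_pair, finrank_span_eq_card hind]
      simp
  have hxU : x.rep ∈ U := hx
  rw [← hspan] at hxU
  refine Submodule.span_le.2 ?_ hxU
  rintro _ (rfl | rfl)
  · exact h₁ hp
  · exact h₂ hq

theorem mem_linesUnion {Y₁ Y₂ : Set (Pn K n)} {p q x : Pn K n} (hp : p ∈ Y₁) (hq : q ∈ Y₂)
    (hpq : p ≠ q)
    (hx : x.rep ∈ Submodule.span K {p.rep, q.rep}) : x ∈ linesUnion K (joiningComponent K Y₁ Y₂) :=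
    by
  have h := linearIndependent_rep_of_ne hpq
  refine Set.mem_biUnion (subset_closure (lineOf_mem_joinLines (rep_mem_affineCone.2 hp)
    (rep_mem_affineCone.2 hq) h)) ?_
  change x.rep ∈ Submodule.span K (Set.range ![p.rep, q.rep])
  rwa [range_pair]

theorem affineCone_vanishingIdeal_injOn {Y Z : Set (Pn K n)} (hY : IsClosed Y) (hYne : Y.Nonempty)
    (hZ : IsClosed Z) (hZne : Z.Nonempty)
    (h : vanishingIdeal K (affineCone Y) = vanishingIdeal K (affineCone Z)) : Y = Z := by
  apply affineCone_injective
  rw [← zeroLocus_vanishingIdeal_affineCone hY hYne, h, zeroLocus_vanishingIdeal_affineCone hZ hZne]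

theorem exists_mem_notMem_of_sdim_eq [IsAlgClosed K] [CharZero K] {Y Z : Set (Pn K n)}
    (hY : IsClosed Y)
    (hYirr : IsIrreducible Y) (hZ : IsClosed Z) (hZirr : IsIrreducible Z) {k : ℕ}
    (hYk : sdim Y = (k : WithBot ℕ∞)) (hZk : sdim Z = (k : WithBot ℕ∞)) (hne : Y ≠ Z) :
    ∃ x ∈ Y, x ∉ Z := by
  by_contra! h
  have := isPrime_vanishingIdeal_affineCone hYirr
  have := isPrime_vanishingIdeal_affineCone hZirr
  refine hne (affineCone_vanishingIdeal_injOn hY hYirr.nonempty hZ hZirr.nonempty ?_)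
  refine (eq_of_idim_le (vanishingIdeal_anti_mono (affineCone_mono h)) ?_).symm
  rw [idim_vanishingIdeal_affineCone hY hYirr hYk, idim_vanishingIdeal_affineCone hZ hZirr hZk]

theorem projLinear_subset_linesUnion [IsAlgClosed K] [CharZero K] {Y₁ Y₂ : Set (Pn K n)} {k : ℕ}
    (h₁ : ∃ p ∈ Y₁, p ∉ Y₂) (h₂ : ∃ q ∈ Y₂, q ∉ Y₁) (hcl : IsClosed Y₂) (hirr : IsIrreducible Y₂)
    (hd : sdim Y₂ = (k : WithBot ℕ∞)) {W : Submodule K (Fin (n + 1) → K)}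
    (hW : Module.finrank K W = k + 2) (hW₁ : Y₁ ⊆ projLinear K W) (hW₂ : Y₂ ⊆ projLinear K W) :
    projLinear K W ⊆ linesUnion K (joiningComponent K Y₁ Y₂) := by
  intro x hxW
  obtain ⟨p, hp₁, hp₂⟩ := h₁
  obtain ⟨q, hq₂, hq₁⟩ := h₂
  by_cases hx₁ : x ∈ Y₁
  · exact mem_linesUnion hx₁ hq₂ (fun h => hq₁ (h ▸ hx₁)) (Submodule.subset_span (by simp))
  by_cases hx₂ : x ∈ Y₂
  · exact mem_linesUnion hp₁ hx₂ (fun h => hp₂ (h ▸ hx₂)) (Submodule.subset_span (by simp))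
  obtain ⟨s, hs⟩ := exists_add_smul_mem (isPrime_vanishingIdeal_affineCone hirr)
      (isCone_affineCone Y₂)
    (zeroLocus_vanishingIdeal_affineCone hcl hirr.nonempty)
    (idim_vanishingIdeal_affineCone hcl hirr hd) hW (affineCone_subset_iff.2 hW₂) hxW
    (fun h => hx₂ (rep_mem_affineCone.1 h)) (hW₁ hp₁)
  have hs0 : s ≠ 0 := by
    rintro rfl
    rw [zero_smul, add_zero] at hs
    exact hp₂ (rep_mem_affineCone.1 hs)
  have hv0 : p.rep + s • x.rep ≠ 0 := by
    intro h
    refine hx₁ ((?_ : p = x) ▸ hp₁)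
    rw [← p.mk_rep, ← x.mk_rep]
    refine (Projectivization.mk_eq_mk_iff' K _ _ _ _).2 ⟨-s, ?_⟩
    rw [neg_smul, eq_comm]
    exact eq_neg_of_add_eq_zero_left h
  have hr := (mem_affineCone_iff hv0).1 hs
  refine mem_linesUnion hp₁ hr (fun h => hp₂ (h ▸ hr)) ?_
  obtain ⟨c, hc⟩ := (Projectivization.mk_eq_mk_iff' K _ _ hv0 (Projectivization.rep_nonzero _)).1
    (Projectivization.mk_rep (Projectivization.mk K _ hv0)).symm
  rw [Submodule.mem_span_pair]
  refine ⟨-s⁻¹, s⁻¹ * c, ?_⟩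
  rw [mul_smul, hc, smul_add, smul_smul, inv_mul_cancel₀ hs0]
  simp

end JoinCone

open JoinCone

/-- **Trisecant-lemma paper, Theorem 7.** Let `n = 2k + 1` be odd, `Y₁ ≠ Y₂` irreducible
closed varieties in `ℙⁿ` of dimension `k`, and `S` the joining component of `J(Y₁,Y₂)`,
which has dimension `n - 1`. If there is a third irreducible closed variety `Y` of dimension
`k`, distinct from `Y₁` and `Y₂`, with `S ⊆ Δ(Y)`, then `Y₁`, `Y₂` and `Y` lie in one and the
same `(k+1)`-dimensional projective linear subspace, which equals the union of the lines of
`S`. -/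
theorem three_equal_dim_varieties_in_linear_space
    (K : Type) [Field K] [IsAlgClosed K] [CharZero K]
    (n k : ℕ) (hn : n = 2 * k + 1)
    (Y₁ Y₂ Y : Set (Pn K n))
    (h₁cl : IsClosed Y₁) (h₁irr : IsIrreducible Y₁)
    (h₂cl : IsClosed Y₂) (h₂irr : IsIrreducible Y₂)
    (hne : Y₁ ≠ Y₂)
    (hd₁ : sdim Y₁ = (k : WithBot ℕ∞)) (hd₂ : sdim Y₂ = (k : WithBot ℕ∞))
    (hS : sdim (joiningComponent K Y₁ Y₂) = ((n - 1 : ℕ) : WithBot ℕ∞))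
    (hYcl : IsClosed Y) (hYirr : IsIrreducible Y)
    (hYd : sdim Y = (k : WithBot ℕ∞)) (hYne₁ : Y ≠ Y₁) (hYne₂ : Y ≠ Y₂)
    (hSY : joiningComponent K Y₁ Y₂ ⊆ Delta K Y) :
    ∃ W : Submodule K (Fin (n + 1) → K), Module.finrank K W = k + 2 ∧
      Y₁ ⊆ projLinear K W ∧ Y₂ ⊆ projLinear K W ∧ Y ⊆ projLinear K W ∧
      projLinear K W = linesUnion K (joiningComponent K Y₁ Y₂) := by
  have hinj {Y Z : Set (Pn K n)} (hY : IsClosed Y) (hYi : IsIrreducible Y) (hZ : IsClosed Z)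
      (hZi : IsIrreducible Z) (hYZ : Y ≠ Z) :
      vanishingIdeal K (affineCone Y) ≠ vanishingIdeal K (affineCone Z) := fun h =>
    hYZ (affineCone_vanishingIdeal_injOn hY hYi.nonempty hZ hZi.nonempty h)
  obtain ⟨W, hW, hW₁, hW₂, hWY⟩ := exists_common_subspace
    (isPrime_vanishingIdeal_affineCone h₁irr) (isPrime_vanishingIdeal_affineCone h₂irr)
    (isPrime_vanishingIdeal_affineCone hYirr)
    (isCone_affineCone Y₁) (isCone_affineCone Y₂) (isCone_affineCone Y)
    (zeroLocus_vanishingIdeal_affineCone h₁cl h₁irr.nonempty)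
    (zeroLocus_vanishingIdeal_affineCone h₂cl h₂irr.nonempty)
    (idim_vanishingIdeal_affineCone h₁cl h₁irr hd₁)
    (idim_vanishingIdeal_affineCone h₂cl h₂irr hd₂)
    (idim_vanishingIdeal_affineCone hYcl hYirr hYd)
    (hinj h₁cl h₁irr h₂cl h₂irr hne) (hinj hYcl hYirr h₁cl h₁irr hYne₁)
    (hinj hYcl hYirr h₂cl h₂irr hYne₂)
    fun a ha b hb hab => exists_combination_mem hSY ha hb hab
  rw [affineCone_subset_iff] at hW₁ hW₂ hWY
  exact ⟨W, hW, hW₁, hW₂, hWY, subset_antisymm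
    (projLinear_subset_linesUnion
      (exists_mem_notMem_of_sdim_eq h₁cl h₁irr h₂cl h₂irr hd₁ hd₂ hne)
      (exists_mem_notMem_of_sdim_eq h₂cl h₂irr h₁cl h₁irr hd₂ hd₁ hne.symm)
      h₂cl h₂irr hd₂ hW hW₁ hW₂)
    (linesUnion_joiningComponent_subset hW₁ hW₂)⟩
end
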